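/- arXiv:2501.09912 — 2 statements merged into one kernel-verified Lean document; each statement's English description precedes it below -/
import Mathlib

section
/- Let n ≥ 1, let 1 < q < ∞, let w ∈ A_q be a weight on ℝⁿ, let 1 < p < ∞, and let N : [1,∞) → (0,∞) be increasing. Then there exists a constant C > 0 such that ‖f‖_{L^q(w)} ≤ C‖g‖_{L^q(w)} for every pair (f,g) ∈ F(p,N). -/
open MeasureTheory ENNReal NNReal Filter Topology

noncomputable section

/-- Euclidean space ℝⁿ. -/
abbrev Eucl (n : ℕ) := EuclideanSpace ℝ (Fin n)

/-- The axes-parallel closed cube with center `x` and radius `r`. -/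
def cubeSet {n : ℕ} (x : Eucl n) (r : ℝ) : Set (Eucl n) :=
  {y | ∀ i, |x i - y i| ≤ r}

/-- The Muckenhoupt `A_p` characteristic
`[w]_{A_p} = sup_Q (|Q|⁻¹∫_Q w) (|Q|⁻¹∫_Q w^{-1/(p-1)})^{p-1}`. -/
def apConst (n : ℕ) (p : ℝ) (w : Eucl n → ℝ≥0∞) : ℝ≥0∞ :=
  ⨆ (x : Eucl n) (r : ℝ) (_ : 0 < r),
    ((volume (cubeSet x r))⁻¹ * ∫⁻ y in cubeSet x r, w y) *
      ((volume (cubeSet x r))⁻¹ * ∫⁻ y in cubeSet x r, w y ^ (-(1/(p-1)))) ^ (p-1)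

/-- A weight: measurable, positive and finite a.e. -/
def IsWeight {n : ℕ} (w : Eucl n → ℝ≥0∞) : Prop :=
  Measurable w ∧ ∀ᵐ x ∂(volume : Measure (Eucl n)), 0 < w x ∧ w x < ⊤

/-- `w ∈ A_p`. -/
def MemAp (n : ℕ) (p : ℝ) (w : Eucl n → ℝ≥0∞) : Prop :=
  IsWeight w ∧ apConst n p w < ⊤

/-- The weighted Lebesgue norm, for an `ℝ≥0∞`-valued function. -/
def wLpE (n : ℕ) (p : ℝ) (w : Eucl n → ℝ≥0∞) (F : Eucl n → ℝ≥0∞) : ℝ≥0∞ :=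
  (∫⁻ x, F x ^ p * w x) ^ (1/p)

/-- The weighted Lebesgue norm `‖f‖_{L^p(w)} = (∫ |f|^p w)^{1/p}`. -/
def wLp (n : ℕ) (p : ℝ) (w : Eucl n → ℝ≥0∞) (f : Eucl n → ℝ) : ℝ≥0∞ :=
  wLpE n p w (fun x => (‖f x‖₊ : ℝ≥0∞))

/-- The extrapolation family `F(p,N)`: pairs of measurable functions `(f,g)` with
`‖f‖_{L^p(w)} ≤ N([w]_{A_p}) ‖g‖_{L^p(w)}` for every `w ∈ A_p`. -/
def memF (n : ℕ) (p : ℝ) (N : ℝ → ℝ) (f g : Eucl n → ℝ) : Prop :=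
  Measurable f ∧ Measurable g ∧
    ∀ w : Eucl n → ℝ≥0∞, MemAp n p w →
      wLp n p w f ≤ ENNReal.ofReal (N ((apConst n p w).toReal)) * wLp n p w g


namespace Extrap

lemma cube_eq {n : ℕ} (x : Eucl n) (r : ℝ) (hr : 0 ≤ r) :
    cubeSet x r = (WithLp.ofLp : Eucl n → (Fin n → ℝ)) ⁻¹' Metric.closedBall (WithLp.ofLp x) r := by
  ext y
  simp only [cubeSet, Set.mem_ofPred_eq, Set.mem_preimage, Metric.mem_closedBall,
    dist_pi_le_iff hr, Real.dist_eq]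
  exact forall_congr' fun i => by rw [abs_sub_comm]

lemma cube_meas {n : ℕ} (x : Eucl n) (r : ℝ) : MeasurableSet (cubeSet x r) := by
  have : cubeSet x r = ⋂ i, {y : Eucl n | |x i - y i| ≤ r} := by ext; simp [cubeSet]
  rw [this]
  refine MeasurableSet.iInter fun i => measurableSet_le ?_ measurable_const
  fun_prop

lemma cube_vol {n : ℕ} (x : Eucl n) (r : ℝ) (hr : 0 ≤ r) :
    volume (cubeSet x r) = ENNReal.ofReal ((2 * r) ^ n) := by
  rw [cube_eq x r hr, (PiLp.volume_preserving_ofLp (Fin n)).measure_preimage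
    measurableSet_closedBall.nullMeasurableSet, Real.volume_pi_closedBall _ hr]
  simp

lemma cube_vol_ne_top {n : ℕ} (x : Eucl n) (r : ℝ) (hr : 0 < r) :
    volume (cubeSet x r) ≠ ⊤ := by rw [cube_vol _ _ hr.le]; simp

lemma cube_vol_ne_zero {n : ℕ} (x : Eucl n) (r : ℝ) (hr : 0 < r) :
    volume (cubeSet x r) ≠ 0 := by
  rw [cube_vol _ _ hr.le]; simp only [ne_eq, ENNReal.ofReal_eq_zero, not_le]; positivity

lemma cube_vol_scale {n : ℕ} (x y : Eucl n) (r s c : ℝ) (hr : 0 < r) (hs : 0 < s) (hc : 0 ≤ c)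
    (h : s ≤ c * r) :
    volume (cubeSet y s) ≤ ENNReal.ofReal (c ^ n) * volume (cubeSet x r) := by
  rw [cube_vol _ _ hr.le, cube_vol _ _ hs.le, ← ENNReal.ofReal_mul (by positivity), ← mul_pow]
  apply ENNReal.ofReal_le_ofReal
  apply pow_le_pow_left₀ (by positivity)
  linarith

/-- Countable index set of cubes. -/
abbrev Idx : Type := ℕ × {ρ : ℚ // 0 < ρ}

/-- centre -/
def ctr {n : ℕ} (i : Idx) : Eucl n := TopologicalSpace.denseSeq (Eucl n) i.1

/-- radius -/
def rad (i : Idx) : ℝ := ((i.2.1 : ℚ) : ℝ)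

lemma rad_pos (i : Idx) : 0 < rad i := by
  have := i.2.2; unfold rad; exact_mod_cast this

/-- countable family of cubes -/
def cb {n : ℕ} (i : Idx) : Set (Eucl n) := cubeSet (ctr i) (rad i)

lemma cb_meas {n : ℕ} (i : Idx) : MeasurableSet (cb (n := n) i) := cube_meas _ _

lemma exists_cb {n : ℕ} (x : Eucl n) (r : ℝ) (hr : 0 < r) :
    ∃ i : Idx, cubeSet x r ⊆ cb i ∧ rad i ≤ 2 * r := by
  obtain ⟨ρ, h1, h2⟩ := exists_rat_btwn (show r < 2 * r by linarith)
  obtain ⟨j, hj⟩ := (TopologicalSpace.denseRange_denseSeq (Eucl n)).exists_dist_lt x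
    (show 0 < (ρ : ℝ) - r by linarith)
  have hρ : 0 < ρ := by exact_mod_cast hr.trans h1
  refine ⟨(j, ⟨ρ, hρ⟩), ?_, h2.le⟩
  intro y hy i
  have hy := hy i
  have h3 : |x i - TopologicalSpace.denseSeq (Eucl n) j i| ≤
      dist x (TopologicalSpace.denseSeq (Eucl n) j) := by
    have := PiLp.norm_apply_le (x - TopologicalSpace.denseSeq (Eucl n) j) i
    simpa [dist_eq_norm] using this
  show |TopologicalSpace.denseSeq (Eucl n) j i - y i| ≤ (ρ : ℝ)
  rw [abs_sub_comm] at h3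
  have := abs_sub_le (TopologicalSpace.denseSeq (Eucl n) j i) (x i) (y i)
  linarith

/-- maximal function -/
def MM {n : ℕ} (μ : Measure (Eucl n)) (f : Eucl n → ℝ≥0∞) (x : Eucl n) : ℝ≥0∞ :=
  ⨆ i : Idx, (cb i).indicator (fun _ => (μ (cb i))⁻¹ * ∫⁻ y in cb i, f y ∂μ) x

lemma MM_meas {n : ℕ} (μ : Measure (Eucl n)) (f : Eucl n → ℝ≥0∞) : Measurable (MM μ f) :=
  Measurable.iSup fun i => measurable_const.indicator (cb_meas i)

lemma le_MM {n : ℕ} (μ : Measure (Eucl n)) (f : Eucl n → ℝ≥0∞) (i : Idx) (x : Eucl n)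
    (hx : x ∈ cb i) : (μ (cb i))⁻¹ * ∫⁻ y in cb i, f y ∂μ ≤ MM μ f x := by
  refine le_iSup_of_le i ?_
  simp [hx]

lemma MM_le {n : ℕ} (μ : Measure (Eucl n)) (f : Eucl n → ℝ≥0∞) (x : Eucl n) (B : ℝ≥0∞)
    (h : ∀ i : Idx, x ∈ cb i → (μ (cb i))⁻¹ * ∫⁻ y in cb i, f y ∂μ ≤ B) : MM μ f x ≤ B := by
  refine iSup_le fun i => ?_
  by_cases hx : x ∈ cb i
  · simpa [hx] using h i hx
  · simp [hx]

lemma weak {n : ℕ} (μ : Measure (Eucl n)) (D : ℝ≥0∞)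
    (hD : ∀ i : Idx, μ (cubeSet (ctr i) (5 * rad i)) ≤ D * μ (cb i))
    (ht : ∀ i : Idx, μ (cb i) ≠ ⊤) (h0 : ∀ i : Idx, μ (cb i) ≠ 0)
    (f : Eucl n → ℝ≥0∞) (hf : Measurable f) (l : ℝ≥0∞) (hl : l ≠ ⊤) :
    l * μ {x | 2 * l < MM μ f x} ≤ D * ∫⁻ x in {x | l < f x}, f x ∂μ := by
  set T : Set Idx := {i | 2 * l < (μ (cb i))⁻¹ * ∫⁻ y in cb i, f y ∂μ} with hT
  have hset : {x | 2 * l < MM μ f x} ⊆ ⋃ t : Finset T, ⋃ i ∈ t, cb i.1 := by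
    intro x hx
    obtain ⟨i, hi⟩ := lt_iSup_iff.1 (show 2 * l < MM μ f x from hx)
    by_cases hxi : x ∈ cb i
    · rw [Set.indicator_of_mem hxi] at hi
      simp only [Set.mem_iUnion]
      exact ⟨{⟨i, hi⟩}, ⟨i, hi⟩, by simp, hxi⟩
    · rw [Set.indicator_of_notMem hxi] at hi
      simp at hi
  have hgm : MeasurableSet {x | l < f x} := measurableSet_lt measurable_const hf
  have key : ∀ i ∈ T, l * μ (cb i) ≤ ∫⁻ y in cb i, ({x | l < f x}).indicator f y ∂μ := by
    intro i hi
    have hi : 2 * l < (μ (cb i))⁻¹ * ∫⁻ y in cb i, f y ∂μ := hi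
    have h1 : 2 * l * μ (cb i) ≤ ∫⁻ y in cb i, f y ∂μ := by
      calc 2 * l * μ (cb i) ≤ ((μ (cb i))⁻¹ * ∫⁻ y in cb i, f y ∂μ) * μ (cb i) := by gcongr
        _ = ((μ (cb i))⁻¹ * μ (cb i)) * ∫⁻ y in cb i, f y ∂μ := by ring
        _ = _ := by rw [ENNReal.inv_mul_cancel (h0 i) (ht i), one_mul]
    have h2 : ∫⁻ y in cb i, f y ∂μ ≤
        (∫⁻ y in cb i, ({x | l < f x}).indicator f y ∂μ) + l * μ (cb i) := by
      calc ∫⁻ y in cb i, f y ∂μ ≤ ∫⁻ y in cb i, (({x | l < f x}).indicator f y + l) ∂μ := by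
            apply lintegral_mono
            intro y
            by_cases hy : l < f y
            · simp [hy]
            · simp only [Set.indicator, Set.mem_ofPred_eq, hy, if_false, zero_add]
              exact not_lt.1 hy
        _ = _ := by
            rw [lintegral_add_right _ measurable_const]
            simp
    have h3 : l * μ (cb i) + l * μ (cb i) ≤
        (∫⁻ y in cb i, ({x | l < f x}).indicator f y ∂μ) + l * μ (cb i) := by
      refine le_trans (le_of_eq (by ring)) (h1.trans h2)
    exact (ENNReal.add_le_add_iff_right (ENNReal.mul_ne_top hl (ht i))).1 h3
  have fin : ∀ t : Finset T, l * μ (⋃ i ∈ t, cb i.1) ≤ D * ∫⁻ x in {x | l < f x}, f x ∂μ := by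
    intro t
    obtain ⟨u, hut, hdis, hcov⟩ := Vitali.exists_disjoint_subfamily_covering_enlargement
      (fun i : T => cb (n := n) i.1) (t : Set T) (fun i => rad i.1) 2 (by norm_num)
      (fun i _ => (rad_pos _).le) (∑ i ∈ t, rad i.1)
      (fun i hi => Finset.single_le_sum (f := fun i : T => rad i.1)
        (fun j _ => (rad_pos _).le) hi)
      (fun i _ => ⟨ctr i.1, fun j => by simpa using (rad_pos _).le⟩)
    have hufin : u.Finite := t.finite_toSet.subset hut
    have hsub : (⋃ i ∈ t, cb (n := n) i.1) ⊆
        ⋃ i ∈ hufin.toFinset, cubeSet (ctr i.1) (5 * rad i.1) := by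
      intro x hx
      simp only [Set.mem_iUnion] at hx
      obtain ⟨a, ha, hxa⟩ := hx
      obtain ⟨b, hb, ⟨z, hza, hzb⟩, hr⟩ := hcov a ha
      simp only [Set.mem_iUnion]
      refine ⟨b, by simpa using hb, fun j => ?_⟩
      have e1 := hxa j
      have e2 := hza j
      have e3 := hzb j
      rw [abs_le] at *
      constructor <;> linarith [e1.1, e1.2, e2.1, e2.2, e3.1, e3.2]
    calc l * μ (⋃ i ∈ t, cb i.1)
        ≤ l * ∑ i ∈ hufin.toFinset, μ (cubeSet (ctr i.1) (5 * rad i.1)) := by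
          gcongr
          exact (measure_mono hsub).trans (measure_biUnion_finset_le _ _)
      _ ≤ l * ∑ i ∈ hufin.toFinset, D * μ (cb i.1) := by
          gcongr with i hi
          exact hD _
      _ = D * ∑ i ∈ hufin.toFinset, l * μ (cb i.1) := by
          rw [Finset.mul_sum, Finset.mul_sum]
          exact Finset.sum_congr rfl fun _ _ => by ring
      _ ≤ D * ∑ i ∈ hufin.toFinset, ∫⁻ y in cb i.1, ({x | l < f x}).indicator f y ∂μ := by
          gcongr with i hi
          exact key _ i.2
      _ = D * ∫⁻ y in ⋃ i ∈ hufin.toFinset, cb i.1, ({x | l < f x}).indicator f y ∂μ := by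
          rw [lintegral_biUnion_finset]
          · intro a ha b hb hab
            exact hdis (by simpa using ha) (by simpa using hb) hab
          · intro i _
            exact cb_meas _
      _ ≤ D * ∫⁻ y, ({x | l < f x}).indicator f y ∂μ := by
          exact mul_le_mul_right (setLIntegral_le_lintegral _ _) _
      _ = _ := by rw [lintegral_indicator hgm]
  calc l * μ {x | 2 * l < MM μ f x} ≤ l * μ (⋃ t : Finset T, ⋃ i ∈ t, cb i.1) := by
        gcongr
    _ = ⨆ t : Finset T, l * μ (⋃ i ∈ t, cb i.1) := by
        rw [Directed.measure_iUnion, ENNReal.mul_iSup]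
        apply Monotone.directed_le
        intro s t hst
        exact Set.biUnion_subset_biUnion_left hst
    _ ≤ _ := iSup_le fin

lemma L1 (q : ℝ) (hq : 1 < q) (a : ℝ≥0∞) :
    a ^ q ≤ ∑' k : ℤ, if 2 * (2 : ℝ≥0∞) ^ k < a then (4 * (2 : ℝ≥0∞) ^ k) ^ q else 0 := by
  by_cases h0 : a = 0
  · subst h0
    rw [ENNReal.zero_rpow_of_pos (by linarith)]; exact bot_le
  by_cases ht : a = ⊤
  · subst ht
    have h2 : ∀ k : ℤ, 2 * (2 : ℝ≥0∞) ^ k < ⊤ := fun k =>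
      ENNReal.mul_lt_top (by simp) (ENNReal.zpow_lt_top (by simp) (by simp) k)
    simp only [h2, if_true]
    have : ∑' k : ℕ, (1 : ℝ≥0∞) ≤ ∑' k : ℤ, (4 * (2 : ℝ≥0∞) ^ k) ^ q := by
      refine le_trans ?_ (ENNReal.tsum_comp_le_tsum_of_injective (f := fun k : ℕ => (k : ℤ))
        Nat.cast_injective _)
      refine ENNReal.tsum_le_tsum fun k => ?_
      apply ENNReal.one_le_rpow _ (by linarith)
      rw [zpow_natCast]
      calc (1 : ℝ≥0∞) = 1 * 1 := by simp
        _ ≤ 4 * 2 ^ k := by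
          gcongr
          · norm_num
          · exact one_le_pow₀ (by norm_num)
    rw [ENNReal.tsum_const_eq_top_of_ne_zero one_ne_zero] at this
    exact le_top.trans this
  · obtain ⟨k, hk1, hk2⟩ := ENNReal.exists_mem_Ioc_zpow (x := a / 2) (y := 2)
      (by simp [h0]) (ENNReal.div_ne_top ht (by simp)) (by norm_num) (by simp)
    refine le_trans ?_ (ENNReal.le_tsum k)
    have e1 : 2 * (2 : ℝ≥0∞) ^ k < a := by
      rw [ENNReal.lt_div_iff_mul_lt (by simp) (by simp)] at hk1
      rwa [mul_comm]
    rw [if_pos e1]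
    apply ENNReal.rpow_le_rpow _ (by linarith)
    rw [ENNReal.div_le_iff (by simp) (by simp), ENNReal.zpow_add (by simp) (by simp)] at hk2
    refine hk2.trans (le_of_eq ?_)
    rw [zpow_one, mul_assoc, mul_comm]; norm_num

lemma L2 (q : ℝ) (hq : 1 < q) (b : ℝ≥0∞) :
    (∑' k : ℤ, if (2 : ℝ≥0∞) ^ k < b then ((2 : ℝ≥0∞) ^ k) ^ (q - 1) else 0) ≤
      (∑' j : ℕ, ((2 : ℝ≥0∞)⁻¹ ^ (q - 1)) ^ j) * b ^ (q - 1) := by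
  by_cases h0 : b = 0
  · subst h0; simp
  by_cases ht : b = ⊤
  · subst ht
    rw [ENNReal.top_rpow_of_pos (by linarith), ENNReal.mul_top]
    · exact le_top
    · refine ne_of_gt (lt_of_lt_of_le ?_ (ENNReal.le_tsum 0))
      simp
  · obtain ⟨m, hm1, hm2⟩ := ENNReal.exists_mem_Ioc_zpow (x := b) (y := 2)
      h0 ht (by norm_num) (by simp)
    have hinj : Function.Injective (fun j : ℕ => m - (j : ℤ)) := by
      intro a b h; simpa using h
    rw [← hinj.tsum_eq (f := fun k : ℤ => if (2 : ℝ≥0∞) ^ k < b then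
      ((2 : ℝ≥0∞) ^ k) ^ (q - 1) else 0), ← ENNReal.tsum_mul_right]
    · refine ENNReal.tsum_le_tsum fun j => ?_
      split_ifs with h
      · rw [ENNReal.zpow_sub (by simp) (by simp), zpow_natCast, ← div_eq_mul_inv,
          ENNReal.div_rpow_of_nonneg _ _ (by linarith), div_eq_mul_inv, mul_comm]
        gcongr
        rw [← ENNReal.inv_rpow, ENNReal.inv_pow, ← ENNReal.rpow_natCast,
          ← ENNReal.rpow_natCast, ← ENNReal.rpow_mul, ← ENNReal.rpow_mul, mul_comm]
      · exact bot_le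
    · intro k hk
      simp only [Function.mem_support, ne_eq, ite_eq_right_iff, Classical.not_imp] at hk
      have : (2 : ℝ≥0∞) ^ k < 2 ^ (m + 1) := hk.1.trans_le hm2
      have hlt : k < m + 1 := by
        by_contra hc
        exact absurd (ENNReal.zpow_le_of_le (by norm_num) (not_lt.1 hc)) (not_le.2 this)
      exact ⟨(m - k).toNat, by simp only; omega⟩

lemma geo (q : ℝ) (hq : 1 < q) : (∑' j : ℕ, ((2 : ℝ≥0∞)⁻¹ ^ (q - 1)) ^ j) ≠ ⊤ := by
  rw [ENNReal.tsum_geometric]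
  have : (2 : ℝ≥0∞)⁻¹ ^ (q - 1) < 1 := ENNReal.rpow_lt_one (by norm_num) (by linarith)
  simp [tsub_eq_zero_iff_le, this]

lemma strong {n : ℕ} (μ : Measure (Eucl n)) (D : ℝ≥0∞) (hDt : D ≠ ⊤)
    (hD : ∀ i : Idx, μ (cubeSet (ctr i) (5 * rad i)) ≤ D * μ (cb i))
    (ht : ∀ i : Idx, μ (cb i) ≠ ⊤) (h0 : ∀ i : Idx, μ (cb i) ≠ 0) (q : ℝ) (hq : 1 < q) :
    ∃ K : ℝ≥0∞, K ≠ ⊤ ∧ ∀ f : Eucl n → ℝ≥0∞, Measurable f →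
      ∫⁻ x, (MM μ f x) ^ q ∂μ ≤ K * ∫⁻ x, f x ^ q ∂μ := by
  refine ⟨4 ^ q * D * ∑' j : ℕ, ((2 : ℝ≥0∞)⁻¹ ^ (q - 1)) ^ j, ?_, fun f hf => ?_⟩
  · exact ENNReal.mul_ne_top (ENNReal.mul_ne_top (by simp) hDt) (geo q hq)
  have h2t : ∀ k : ℤ, (2 : ℝ≥0∞) ^ k ≠ ⊤ := fun k =>
    (ENNReal.zpow_lt_top (by simp) (by simp) k).ne
  have h20 : ∀ k : ℤ, (2 : ℝ≥0∞) ^ k ≠ 0 := fun k =>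
    (ENNReal.zpow_pos (by simp) (by simp) k).ne'
  have hsm : ∀ k : ℤ, MeasurableSet {x | 2 * (2 : ℝ≥0∞) ^ k < MM μ f x} := fun k =>
    measurableSet_lt measurable_const (MM_meas μ f)
  have hsf : ∀ k : ℤ, MeasurableSet {x | (2 : ℝ≥0∞) ^ k < f x} := fun k =>
    measurableSet_lt measurable_const hf
  calc ∫⁻ x, (MM μ f x) ^ q ∂μ
      ≤ ∫⁻ x, ∑' k : ℤ, ({x | 2 * (2 : ℝ≥0∞) ^ k < MM μ f x}).indicator
          (fun _ => (4 * (2 : ℝ≥0∞) ^ k) ^ q) x ∂μ := by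
        apply lintegral_mono
        intro x
        simpa [Set.indicator] using L1 q hq (MM μ f x)
    _ = ∑' k : ℤ, (4 * (2 : ℝ≥0∞) ^ k) ^ q * μ {x | 2 * (2 : ℝ≥0∞) ^ k < MM μ f x} := by
        rw [lintegral_tsum (fun k => (measurable_const.indicator (hsm k)).aemeasurable)]
        congr 1; ext k
        rw [lintegral_indicator_const (hsm k)]
    _ ≤ ∑' k : ℤ, 4 ^ q * D * (((2 : ℝ≥0∞) ^ k) ^ (q - 1) *
          ∫⁻ x, ({x | (2 : ℝ≥0∞) ^ k < f x}).indicator f x ∂μ) := by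
        refine ENNReal.tsum_le_tsum fun k => ?_
        have e : ((2 : ℝ≥0∞) ^ k) ^ q = ((2 : ℝ≥0∞) ^ k) ^ (q - 1) * (2 : ℝ≥0∞) ^ k := by
          conv_lhs => rw [show q = (q - 1) + 1 by ring]
          rw [ENNReal.rpow_add _ _ (h20 k) (h2t k), ENNReal.rpow_one]
        rw [ENNReal.mul_rpow_of_nonneg _ _ (by linarith), e, lintegral_indicator (hsf k)]
        calc _ = 4 ^ q * ((2 : ℝ≥0∞) ^ k) ^ (q - 1) *
              ((2 : ℝ≥0∞) ^ k * μ {x | 2 * (2 : ℝ≥0∞) ^ k < MM μ f x}) := by ring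
          _ ≤ 4 ^ q * ((2 : ℝ≥0∞) ^ k) ^ (q - 1) *
              (D * ∫⁻ x in {x | (2 : ℝ≥0∞) ^ k < f x}, f x ∂μ) := by
              exact mul_le_mul_right (weak μ D hD ht h0 f hf _ (h2t k)) _
          _ = _ := by ring
    _ = 4 ^ q * D * ∫⁻ x, ∑' k : ℤ, (((2 : ℝ≥0∞) ^ k) ^ (q - 1) *
          ({x | (2 : ℝ≥0∞) ^ k < f x}).indicator f x) ∂μ := by
        rw [ENNReal.tsum_mul_left, lintegral_tsum]
        · congr 2; ext k
          rw [lintegral_const_mul _ (hf.indicator (hsf k))]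
        · intro k
          exact ((hf.indicator (hsf k)).const_mul _).aemeasurable
    _ ≤ 4 ^ q * D * ∫⁻ x, (∑' j : ℕ, ((2 : ℝ≥0∞)⁻¹ ^ (q - 1)) ^ j) * f x ^ q ∂μ := by
        gcongr with x
        calc ∑' k : ℤ, (((2 : ℝ≥0∞) ^ k) ^ (q - 1) *
              ({x | (2 : ℝ≥0∞) ^ k < f x}).indicator f x)
            = (∑' k : ℤ, if (2 : ℝ≥0∞) ^ k < f x then ((2 : ℝ≥0∞) ^ k) ^ (q - 1) else 0) * f x := by
              rw [← ENNReal.tsum_mul_right]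
              congr 1; ext k
              by_cases h : (2 : ℝ≥0∞) ^ k < f x
              · simp [h]
              · simp [h]
          _ ≤ (∑' j : ℕ, ((2 : ℝ≥0∞)⁻¹ ^ (q - 1)) ^ j) * f x ^ (q - 1) * f x := by
              gcongr
              exact L2 q hq _
          _ = (∑' j : ℕ, ((2 : ℝ≥0∞)⁻¹ ^ (q - 1)) ^ j) * f x ^ q := by
              rw [mul_assoc]; congr 1
              nth_rewrite 2 [← ENNReal.rpow_one (f x)]
              rw [← ENNReal.rpow_add_of_nonneg _ _ (by linarith) (by norm_num)]
              congr 1; ring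
    _ = _ := by
        rw [lintegral_const_mul _ (hf.pow_const q)]; ring

/-- dual weight -/
def sg {n : ℕ} (q : ℝ) (w : Eucl n → ℝ≥0∞) : Eucl n → ℝ≥0∞ := fun x => w x ^ (-(1/(q-1)))

lemma holder_cube {n : ℕ} (q : ℝ) (hq : 1 < q) (w : Eucl n → ℝ≥0∞) (hm : Measurable w)
    (hw : ∀ᵐ x, 0 < w x ∧ w x < ⊤) (Q : Set (Eucl n)) :
    volume Q ^ q ≤ (∫⁻ y in Q, w y) * (∫⁻ y in Q, w y ^ (-(1/(q-1)))) ^ (q-1) := by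
  have hq1 : 0 < q - 1 := by linarith
  have hq0 : 0 < q := by linarith
  have hc := Real.HolderConjugate.conjExponent hq
  have h := ENNReal.lintegral_mul_le_Lp_mul_Lq (volume.restrict Q) hc
    (f := fun y => w y ^ (1/q)) (g := fun y => w y ^ (-(1/q)))
    (hm.pow_const _).aemeasurable (hm.pow_const _).aemeasurable
  have e1 : ∫⁻ y in Q, ((fun y => w y ^ (1/q)) * (fun y => w y ^ (-(1/q)))) y = volume Q := by
    rw [← setLIntegral_one]
    apply lintegral_congr_ae
    filter_upwards [ae_restrict_of_ae hw] with y hy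
    simp only [Pi.mul_apply]
    rw [← ENNReal.rpow_add _ _ hy.1.ne' hy.2.ne]; simp
  have e2 : ∀ y, (w y ^ (1/q)) ^ q = w y := fun y => by
    rw [← ENNReal.rpow_mul, one_div_mul_cancel hq0.ne', ENNReal.rpow_one]
  have e3 : ∀ y, (w y ^ (-(1/q))) ^ (q.conjExponent) = w y ^ (-(1/(q-1))) := fun y => by
    rw [← ENNReal.rpow_mul]; congr 1; unfold Real.conjExponent; field_simp
  rw [e1] at h
  simp only [e2, e3] at h
  calc volume Q ^ q ≤ _ := ENNReal.rpow_le_rpow h hq0.le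
    _ = _ := by
      rw [ENNReal.mul_rpow_of_nonneg _ _ hq0.le, ← ENNReal.rpow_mul, ← ENNReal.rpow_mul,
        one_div_mul_cancel hq0.ne', ENNReal.rpow_one]
      congr 2; unfold Real.conjExponent; field_simp

lemma ap_le {n : ℕ} (q : ℝ) (w : Eucl n → ℝ≥0∞) (x : Eucl n) (r : ℝ) (hr : 0 < r) :
    ((volume (cubeSet x r))⁻¹ * ∫⁻ y in cubeSet x r, w y) *
      ((volume (cubeSet x r))⁻¹ * ∫⁻ y in cubeSet x r, w y ^ (-(1/(q-1)))) ^ (q-1) ≤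
      apConst n q w :=
  le_iSup_of_le x (le_iSup_of_le r (le_iSup_of_le hr le_rfl))

lemma fac (q : ℝ) (hq : 1 < q) (V a b : ℝ≥0∞) (h0 : V ≠ 0) (ht : V ≠ ⊤) :
    (V⁻¹ * a) * (V⁻¹ * b) ^ (q-1) = (V ^ q)⁻¹ * (a * b ^ (q-1)) := by
  have : V ^ q = V * V ^ (q-1) := by
    nth_rewrite 2 [← ENNReal.rpow_one V]
    rw [← ENNReal.rpow_add _ _ h0 ht]; congr 1; ring
  rw [ENNReal.mul_rpow_of_nonneg _ _ (by linarith), this, ENNReal.inv_rpow,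
    ENNReal.mul_inv (Or.inl h0) (Or.inl ht)]
  ring

lemma ap_le' {n : ℕ} (q : ℝ) (hq : 1 < q) (w : Eucl n → ℝ≥0∞) (x : Eucl n) (r : ℝ) (hr : 0 < r) :
    (∫⁻ y in cubeSet x r, w y) * (∫⁻ y in cubeSet x r, sg q w y) ^ (q-1) ≤
      apConst n q w * volume (cubeSet x r) ^ q := by
  have h := ap_le q w x r hr
  have h0 := cube_vol_ne_zero x r hr
  have ht := cube_vol_ne_top x r hr
  rw [fac q hq _ _ _ h0 ht, mul_comm, ← div_eq_mul_inv] at h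
  refine (ENNReal.div_le_iff ?_ ?_).1 h
  · simp [h0, ht]
  · simp [h0, ht]

lemma one_le_ap {n : ℕ} (q : ℝ) (hq : 1 < q) (w : Eucl n → ℝ≥0∞) (hm : Measurable w)
    (hw : ∀ᵐ x, 0 < w x ∧ w x < ⊤) : 1 ≤ apConst n q w := by
  have h0 := cube_vol_ne_zero (0 : Eucl n) 1 one_pos
  have ht := cube_vol_ne_top (0 : Eucl n) 1 one_pos
  refine le_trans ?_ (ap_le q w 0 1 one_pos)
  rw [fac q hq _ _ _ h0 ht]
  calc (1 : ℝ≥0∞) = (volume (cubeSet (0 : Eucl n) 1) ^ q)⁻¹ * volume (cubeSet (0 : Eucl n) 1) ^ q := by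
        rw [ENNReal.inv_mul_cancel] <;> simp [h0, ht]
    _ ≤ _ := by gcongr; exact holder_cube q hq w hm hw _

lemma int_ne_zero {n : ℕ} (w : Eucl n → ℝ≥0∞) (hm : Measurable w) (h0 : ∀ x, w x ≠ 0)
    (x : Eucl n) (r : ℝ) (hr : 0 < r) : ∫⁻ y in cubeSet x r, w y ≠ 0 := by
  rw [← pos_iff_ne_zero, setLIntegral_pos_iff hm]
  have : Function.support w = Set.univ := by ext y; simp [h0]
  rw [this, Set.univ_inter, pos_iff_ne_zero]
  exact cube_vol_ne_zero x r hr

lemma sg_meas {n : ℕ} (q : ℝ) (w : Eucl n → ℝ≥0∞) (hm : Measurable w) : Measurable (sg q w) :=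
  hm.pow_const _

lemma sg_ne_zero {n : ℕ} (q : ℝ) (w : Eucl n → ℝ≥0∞) (h0 : ∀ x, w x ≠ 0)
    (ht : ∀ x, w x ≠ ⊤) (x : Eucl n) : sg q w x ≠ 0 := by
  simp [sg, ENNReal.rpow_eq_zero_iff, h0, ht]

lemma sg_ne_top {n : ℕ} (q : ℝ) (w : Eucl n → ℝ≥0∞) (h0 : ∀ x, w x ≠ 0)
    (ht : ∀ x, w x ≠ ⊤) (x : Eucl n) : sg q w x ≠ ⊤ := by
  simp [sg, ENNReal.rpow_eq_top_iff, h0, ht]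

lemma int_ne_top {n : ℕ} (q : ℝ) (hq : 1 < q) (w : Eucl n → ℝ≥0∞) (hm : Measurable w)
    (h0 : ∀ x, w x ≠ 0) (ht : ∀ x, w x ≠ ⊤) (hA : apConst n q w < ⊤)
    (x : Eucl n) (r : ℝ) (hr : 0 < r) :
    ∫⁻ y in cubeSet x r, w y ≠ ⊤ ∧ ∫⁻ y in cubeSet x r, sg q w y ≠ ⊤ := by
  have h := ap_le' q hq w x r hr
  have h2 : apConst n q w * volume (cubeSet x r) ^ q < ⊤ :=
    ENNReal.mul_lt_top hA (ENNReal.rpow_lt_top_of_nonneg (by linarith) (cube_vol_ne_top x r hr))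
  have h3 := (h.trans_lt h2).ne
  have a0 := int_ne_zero w hm h0 x r hr
  have b0 := int_ne_zero (sg q w) (sg_meas q w hm) (sg_ne_zero q w h0 ht) x r hr
  constructor
  · intro hc
    rw [hc, ENNReal.top_mul] at h3
    · exact h3 rfl
    · simp only [ne_eq, ENNReal.rpow_eq_zero_iff, not_or, not_and, b0, false_imp_iff, true_and]
      intro _; linarith
  · intro hc
    rw [hc, ENNReal.top_rpow_of_pos (by linarith), ENNReal.mul_top a0] at h3
    exact h3 rfl

lemma doubling {n : ℕ} (q : ℝ) (hq : 1 < q) (w : Eucl n → ℝ≥0∞) (hm : Measurable w)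
    (h0 : ∀ x, w x ≠ 0) (ht : ∀ x, w x ≠ ⊤) (hA : apConst n q w < ⊤)
    (x : Eucl n) (r : ℝ) (hr : 0 < r) :
    ∫⁻ y in cubeSet x (5 * r), w y ≤
      apConst n q w * ENNReal.ofReal (5 ^ n) ^ q * ∫⁻ y in cubeSet x r, w y := by
  have hr5 : 0 < 5 * r := by linarith
  have hsub : cubeSet x r ⊆ cubeSet x (5 * r) := fun y hy i => (hy i).trans (by linarith)
  have h := ap_le' q hq w x (5 * r) hr5
  have hh := holder_cube q hq w hm
    (ae_of_all _ fun x => ⟨pos_iff_ne_zero.2 (h0 x), lt_top_iff_ne_top.2 (ht x)⟩) (cubeSet x r)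
  have b0 := int_ne_zero (sg q w) (sg_meas q w hm) (sg_ne_zero q w h0 ht) x (5 * r) hr5
  have bt := (int_ne_top q hq w hm h0 ht hA x (5 * r) hr5).2
  set B := (∫⁻ y in cubeSet x (5 * r), sg q w y) ^ (q - 1) with hB
  have hB0 : B ≠ 0 := by
    rw [hB]
    simp only [ne_eq, ENNReal.rpow_eq_zero_iff, not_or, not_and, b0, false_imp_iff, true_and]
    intro _; linarith
  have hBt : B ≠ ⊤ := ENNReal.rpow_ne_top_of_nonneg (by linarith) bt
  have key : (∫⁻ y in cubeSet x (5 * r), w y) * B ≤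
      (apConst n q w * ENNReal.ofReal (5 ^ n) ^ q * ∫⁻ y in cubeSet x r, w y) * B := by
    calc _ ≤ _ := h
      _ ≤ apConst n q w * (ENNReal.ofReal (5 ^ n) * volume (cubeSet x r)) ^ q := by
          gcongr
          exact cube_vol_scale x x r (5 * r) 5 hr hr5 (by norm_num) le_rfl
      _ = apConst n q w * ENNReal.ofReal (5 ^ n) ^ q * volume (cubeSet x r) ^ q := by
          rw [ENNReal.mul_rpow_of_nonneg _ _ (by linarith)]; ring
      _ ≤ apConst n q w * ENNReal.ofReal (5 ^ n) ^ q * ((∫⁻ y in cubeSet x r, w y) * B) := by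
          refine mul_le_mul_right (hh.trans (mul_le_mul_right ?_ _)) _
          exact ENNReal.rpow_le_rpow (lintegral_mono_set hsub) (by linarith)
      _ = _ := by ring
  exact (ENNReal.mul_le_mul_iff_left hB0 hBt).1 key

lemma sg_sg {n : ℕ} (q : ℝ) (hq : 1 < q) (w : Eucl n → ℝ≥0∞) : sg (q / (q-1)) (sg q w) = w := by
  have : q - 1 ≠ 0 := by linarith
  ext x
  unfold sg
  rw [← ENNReal.rpow_mul]
  have : -(1 / (q - 1)) * -(1 / (q / (q - 1) - 1)) = 1 := by
    have : q / (q-1) - 1 = 1 / (q-1) := by field_simp; ring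
    rw [this]; field_simp
  rw [this, ENNReal.rpow_one]

lemma ap_dual {n : ℕ} (q : ℝ) (hq : 1 < q) (w : Eucl n → ℝ≥0∞) (hA : apConst n q w < ⊤) :
    apConst n (q / (q-1)) (sg q w) < ⊤ := by
  have hq1 : 0 < q - 1 := by linarith
  have hlt : apConst n q w ^ (1 / (q-1)) < ⊤ := ENNReal.rpow_lt_top_of_nonneg (by positivity) hA.ne
  refine lt_of_le_of_lt ?_ hlt
  refine iSup_le fun x => iSup_le fun r => iSup_le fun hr => ?_
  have h := ap_le q w x r hr
  have e := sg_sg q hq w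
  have e' : ∀ y, sg q w y ^ (-(1 / (q / (q-1) - 1))) = w y := fun y => congrFun e y
  simp only [e']
  have e2 : q / (q-1) - 1 = 1 / (q-1) := by field_simp; ring
  rw [e2]
  calc _ = (((volume (cubeSet x r))⁻¹ * ∫⁻ y in cubeSet x r, w y) *
      ((volume (cubeSet x r))⁻¹ * ∫⁻ y in cubeSet x r, w y ^ (-(1/(q-1)))) ^ (q-1)) ^ (1/(q-1)) := by
        generalize (volume (cubeSet x r))⁻¹ * ∫⁻ y in cubeSet x r, w y = a
        rw [ENNReal.mul_rpow_of_nonneg a _ (by positivity), ← ENNReal.rpow_mul _ (q-1),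
          mul_one_div_cancel hq1.ne', ENNReal.rpow_one, mul_comm]
        rfl
    _ ≤ _ := ENNReal.rpow_le_rpow h (by positivity)

/-- A genuinely positive and finite `A_q` weight -/
structure Good (n : ℕ) (q : ℝ) (w : Eucl n → ℝ≥0∞) : Prop where
  hq : 1 < q
  hm : Measurable w
  h0 : ∀ x, w x ≠ 0
  ht : ∀ x, w x ≠ ⊤
  hA : apConst n q w < ⊤

lemma Good.dual {n : ℕ} {q : ℝ} {w : Eucl n → ℝ≥0∞} (h : Good n q w) :
    Good n (q / (q-1)) (sg q w) where
  hq := by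
    have := h.hq
    rw [lt_div_iff₀ (by linarith)]; linarith
  hm := sg_meas q w h.hm
  h0 := sg_ne_zero q w h.h0 h.ht
  ht := sg_ne_top q w h.h0 h.ht
  hA := ap_dual q h.hq w h.hA

lemma strong_w {n : ℕ} {q : ℝ} {w : Eucl n → ℝ≥0∞} (h : Good n q w) (s : ℝ) (hs : 1 < s) :
    ∃ K : ℝ≥0∞, K ≠ ⊤ ∧ ∀ f : Eucl n → ℝ≥0∞, Measurable f →
      ∫⁻ x, (MM (volume.withDensity w) f x) ^ s * w x ≤ K * ∫⁻ x, f x ^ s * w x := by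
  have hμ : ∀ (x : Eucl n) (r : ℝ), volume.withDensity w (cubeSet x r) =
      ∫⁻ y in cubeSet x r, w y := fun x r => withDensity_apply _ (cube_meas x r)
  obtain ⟨K, hK, H⟩ := strong (volume.withDensity w)
    (apConst n q w * ENNReal.ofReal (5 ^ n) ^ q)
    (ENNReal.mul_ne_top h.hA.ne
      (ENNReal.rpow_ne_top_of_nonneg (by linarith [h.hq]) ENNReal.ofReal_ne_top))
    (fun i => by
      rw [cb, hμ, hμ]
      exact doubling q h.hq w h.hm h.h0 h.ht h.hA _ _ (rad_pos i))
    (fun i => by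
      rw [cb, hμ]; exact (int_ne_top q h.hq w h.hm h.h0 h.ht h.hA _ _ (rad_pos i)).1)
    (fun i => by rw [cb, hμ]; exact int_ne_zero w h.hm h.h0 _ _ (rad_pos i)) s hs
  refine ⟨K, hK, fun f hf => ?_⟩
  have := H f hf
  rw [lintegral_withDensity_eq_lintegral_mul _ h.hm ((MM_meas _ f).pow_const s),
    lintegral_withDensity_eq_lintegral_mul _ h.hm (hf.pow_const s)] at this
  simpa [mul_comm] using this

lemma lerner {n : ℕ} {q : ℝ} {w : Eucl n → ℝ≥0∞} (h : Good n q w)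
    (f : Eucl n → ℝ≥0∞) (hf : Measurable f) (x : Eucl n) :
    MM volume f x ^ (q-1) ≤ apConst n q w * MM (volume.withDensity w)
      (fun y => MM (volume.withDensity (sg q w)) (fun z => f z / sg q w z) y ^ (q-1) / w y) x := by
  have hq := h.hq
  have hq1 : 0 < q - 1 := by linarith
  have hsm := sg_meas q w h.hm
  set G := fun y => MM (volume.withDensity (sg q w)) (fun z => f z / sg q w z) y ^ (q-1) with hG
  have hGm : Measurable G := (MM_meas _ _).pow_const _
  set R := MM (volume.withDensity w) (fun y => G y / w y) x with hR
  rw [← ENNReal.le_rpow_inv_iff hq1]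
  refine MM_le _ _ _ _ fun i hx => ?_
  rw [ENNReal.le_rpow_inv_iff hq1]
  have hμ : ∀ (u : Eucl n → ℝ≥0∞), volume.withDensity u (cb i) = ∫⁻ y in cb i, u y :=
    fun u => withDensity_apply _ (cb_meas i)
  have e1 : ∀ (u g : Eucl n → ℝ≥0∞), Measurable u → Measurable g → (∀ x, u x ≠ 0) →
      (∀ x, u x ≠ ⊤) → ∫⁻ y in cb i, g y / u y ∂(volume.withDensity u) = ∫⁻ y in cb i, g y := by
    intro u g hu hg h0 ht
    have hgu : Measurable (fun y => g y / u y) := hg.div hu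
    rw [setLIntegral_withDensity_eq_setLIntegral_mul _ hu hgu (cb_meas i)]
    congr 1; ext y
    exact ENNReal.mul_div_cancel (h0 y) (ht y)
  have f1 := e1 (sg q w) f hsm hf (sg_ne_zero q w h.h0 h.ht) (sg_ne_top q w h.h0 h.ht)
  have f2 := e1 w G h.hm hGm h.h0 h.ht
  have l1 : ∀ y ∈ cb i, (∫⁻ y in cb i, sg q w y)⁻¹ * (∫⁻ y in cb i, f y) ≤
      MM (volume.withDensity (sg q w)) (fun z => f z / sg q w z) y := by
    intro y hy
    have := le_MM (volume.withDensity (sg q w)) (fun z => f z / sg q w z) i y hy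
    rwa [f1, hμ] at this
  have l2 : (∫⁻ y in cb i, w y)⁻¹ * (∫⁻ y in cb i, G y) ≤ R := by
    have := le_MM (volume.withDensity w) (fun z => G z / w z) i x hx
    rwa [f2, hμ] at this
  have hap := ap_le q w (ctr i) (rad i) (rad_pos i)
  have W0 := int_ne_zero w h.hm h.h0 (ctr i) (rad i) (rad_pos i)
  have S0 := int_ne_zero (sg q w) hsm (sg_ne_zero q w h.h0 h.ht) (ctr i) (rad i) (rad_pos i)
  obtain ⟨Wt, St⟩ := int_ne_top q hq w h.hm h.h0 h.ht h.hA (ctr i) (rad i) (rad_pos i)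
  have V0 := cube_vol_ne_zero (ctr (n := n) i) (rad i) (rad_pos i)
  have Vt := cube_vol_ne_top (ctr (n := n) i) (rad i) (rad_pos i)
  change _ * ((volume (cb i))⁻¹ * ∫⁻ y in cb i, sg q w y) ^ (q-1) ≤ _ at hap
  change ((volume (cb i))⁻¹ * ∫⁻ y in cb i, w y) * _ ≤ _ at hap
  change ∫⁻ y in cb i, w y ≠ 0 at W0
  change ∫⁻ y in cb i, w y ≠ ⊤ at Wt
  change ∫⁻ y in cb i, sg q w y ≠ 0 at S0
  change ∫⁻ y in cb i, sg q w y ≠ ⊤ at St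
  change volume (cb i) ≠ 0 at V0
  change volume (cb i) ≠ ⊤ at Vt
  have l3 : ((∫⁻ y in cb i, sg q w y)⁻¹ * (∫⁻ y in cb i, f y)) ^ (q-1) * volume (cb (n := n) i) ≤
      ∫⁻ y in cb i, G y := by
    rw [← setLIntegral_const]
    exact setLIntegral_mono hGm fun y hy => ENNReal.rpow_le_rpow (l1 y hy) hq1.le
  generalize (∫⁻ y in cb i, sg q w y) = S at *
  generalize (∫⁻ y in cb i, w y) = W at *
  generalize (∫⁻ y in cb i, G y) = Gi at *
  generalize (∫⁻ y in cb i, f y) = F at *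
  generalize volume (cb (n := n) i) = V at *
  have l4 : (S⁻¹ * F) ^ (q-1) ≤ V⁻¹ * W * R := by
    calc (S⁻¹ * F) ^ (q-1) = V⁻¹ * ((S⁻¹ * F) ^ (q-1) * V) := by
          rw [mul_comm _ V, ← mul_assoc, ENNReal.inv_mul_cancel V0 Vt, one_mul]
      _ ≤ V⁻¹ * Gi := by gcongr
      _ = V⁻¹ * (W * (W⁻¹ * Gi)) := by
          rw [← mul_assoc W, ENNReal.mul_inv_cancel W0 Wt, one_mul]
      _ ≤ V⁻¹ * (W * R) := by gcongr
      _ = _ := by ring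
  calc (V⁻¹ * F) ^ (q-1) = ((V⁻¹ * S) * (S⁻¹ * F)) ^ (q-1) := by
        congr 1
        rw [mul_assoc, ← mul_assoc S, ENNReal.mul_inv_cancel S0 St, one_mul]
    _ = (V⁻¹ * S) ^ (q-1) * (S⁻¹ * F) ^ (q-1) := ENNReal.mul_rpow_of_nonneg _ _ hq1.le
    _ ≤ (V⁻¹ * S) ^ (q-1) * (V⁻¹ * W * R) := by gcongr
    _ = ((V⁻¹ * W) * (V⁻¹ * S) ^ (q-1)) * R := by ring
    _ ≤ _ := by gcongr

lemma muck {n : ℕ} {q : ℝ} {w : Eucl n → ℝ≥0∞} (h : Good n q w) :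
    ∃ K : ℝ≥0∞, K ≠ ⊤ ∧ ∀ f : Eucl n → ℝ≥0∞, Measurable f →
      ∫⁻ x, MM volume f x ^ q * w x ≤ K * ∫⁻ x, f x ^ q * w x := by
  have hq := h.hq
  have hq1 : 0 < q - 1 := by linarith
  set q' := q / (q-1) with hq'
  have hq'1 : 1 < q' := h.dual.hq
  obtain ⟨K1, hK1, H1⟩ := strong_w h q' hq'1
  obtain ⟨K2, hK2, H2⟩ := strong_w h.dual q hq
  refine ⟨apConst n q w ^ q' * (K1 * K2), ?_, fun f hf => ?_⟩
  · exact ENNReal.mul_ne_top (ENNReal.rpow_ne_top_of_nonneg (by linarith) h.hA.ne)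
      (ENNReal.mul_ne_top hK1 hK2)
  have hsm := sg_meas q w h.hm
  set G := fun y => MM (volume.withDensity (sg q w)) (fun z => f z / sg q w z) y ^ (q-1) with hG
  have hGm : Measurable G := (MM_meas _ _).pow_const _
  calc ∫⁻ x, MM volume f x ^ q * w x
      ≤ ∫⁻ x, apConst n q w ^ q' * (MM (volume.withDensity w) (fun y => G y / w y) x ^ q' * w x) := by
        apply lintegral_mono
        intro x
        have := ENNReal.rpow_le_rpow (lerner h f hf x) (show 0 ≤ q' by linarith)
        rw [← ENNReal.rpow_mul, ENNReal.mul_rpow_of_nonneg _ _ (by linarith),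
          show (q-1) * q' = q by rw [hq']; field_simp] at this
        simp only
        rw [← mul_assoc]
        exact mul_le_mul_left this _
    _ = apConst n q w ^ q' * ∫⁻ x, MM (volume.withDensity w) (fun y => G y / w y) x ^ q' * w x := by
        rw [lintegral_const_mul]
        exact ((MM_meas _ _).pow_const _).mul h.hm
    _ ≤ apConst n q w ^ q' * (K1 * ∫⁻ x, (G x / w x) ^ q' * w x) := by
        exact mul_le_mul_right (H1 _ (hGm.div h.hm)) _
    _ = apConst n q w ^ q' * (K1 * ∫⁻ x, MM (volume.withDensity (sg q w))
          (fun z => f z / sg q w z) x ^ q * sg q w x) := by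
        congr 3; ext x
        rw [ENNReal.div_rpow_of_nonneg _ _ (by linarith), hG]
        simp only
        rw [← ENNReal.rpow_mul, show (q-1) * q' = q by rw [hq']; field_simp, div_eq_mul_inv,
          mul_assoc]
        congr 1
        rw [← ENNReal.rpow_neg]
        nth_rewrite 2 [← ENNReal.rpow_one (w x)]
        rw [← ENNReal.rpow_add _ _ (h.h0 x) (h.ht x)]
        unfold sg; congr 1; rw [hq']; field_simp; ring
    _ ≤ apConst n q w ^ q' * (K1 * (K2 * ∫⁻ x, (f x / sg q w x) ^ q * sg q w x)) := by
        exact mul_le_mul_right (mul_le_mul_right (H2 _ (hf.div hsm)) _) _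
    _ = apConst n q w ^ q' * (K1 * (K2 * ∫⁻ x, f x ^ q * w x)) := by
        congr 4; ext x
        rw [ENNReal.div_rpow_of_nonneg _ _ (by linarith), div_eq_mul_inv, mul_assoc]
        congr 1
        rw [← ENNReal.rpow_neg]
        nth_rewrite 2 [← ENNReal.rpow_one (sg q w x)]
        rw [← ENNReal.rpow_add _ _ (sg_ne_zero q w h.h0 h.ht x) (sg_ne_top q w h.h0 h.ht x)]
        unfold sg
        rw [← ENNReal.rpow_mul]
        nth_rewrite 2 [← ENNReal.rpow_one (w x)]
        congr 1; field_simp; ring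
    _ = _ := by ring

/-- `A_1` condition with constant `K` -/
def AOne {n : ℕ} (K : ℝ≥0∞) (G : Eucl n → ℝ≥0∞) : Prop :=
  ∀ x r, 0 < r → ∀ y ∈ cubeSet x r,
    (volume (cubeSet x r))⁻¹ * ∫⁻ z in cubeSet x r, G z ≤ K * G y

lemma rdf {n : ℕ} {q : ℝ} {w : Eucl n → ℝ≥0∞} (h : Good n q w) :
    ∃ K : ℝ≥0∞, K ≠ ⊤ ∧ 1 ≤ K ∧ ∀ g : Eucl n → ℝ≥0∞, Measurable g →
      ∃ G : Eucl n → ℝ≥0∞, Measurable G ∧ (∀ x, g x ≤ G x) ∧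
        ∫⁻ x, G x ^ q * w x ≤ K * ∫⁻ x, g x ^ q * w x ∧ AOne K G := by
  have hq := h.hq
  have hq0 : 0 < q := by linarith
  obtain ⟨K0, hK0, H⟩ := muck h
  set K1 := K0 + 1 with hK1
  have K1t : K1 ≠ ⊤ := by simp [hK1, hK0]
  have K10 : K1 ≠ 0 := by simp [hK1]
  have K2t : 2 * K1 ≠ ⊤ := ENNReal.mul_ne_top (by simp) K1t
  have K20 : 2 * K1 ≠ 0 := by simp [K10]
  set s : ℝ≥0∞ := (2 * K1) ^ (-(1/q)) with hs
  have s0 : s ≠ 0 := by simp [hs, ENNReal.rpow_eq_zero_iff, K20, K2t]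
  have st : s ≠ ⊤ := by simp [hs, ENNReal.rpow_eq_top_iff, K20, K2t]
  have sq : s ^ q = (2 * K1)⁻¹ := by
    rw [hs, ← ENNReal.rpow_mul, ← ENNReal.rpow_neg_one]; congr 1; field_simp
  clear_value s
  set t : ℝ≥0∞ := 2⁻¹ * s with ht
  have t0 : t ≠ 0 := by simp [ht, s0]
  have tt : t ≠ ⊤ := ENNReal.mul_ne_top (by simp) st
  refine ⟨2 ^ q * 2 + ENNReal.ofReal (2 ^ n) * t⁻¹ + 1, ?_, le_add_self, fun g hg => ?_⟩
  · simp only [ne_eq, ENNReal.add_eq_top, not_or]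
    refine ⟨⟨ENNReal.mul_ne_top (by simp) (by simp),
      ENNReal.mul_ne_top (by simp) (by simp [t0])⟩, by simp⟩
  set It : ℕ → Eucl n → ℝ≥0∞ := fun k => (MM volume)^[k] g with hIt
  have It0 : It 0 = g := rfl
  have ItS : ∀ k, It (k+1) = MM volume (It k) := fun k => Function.iterate_succ_apply' _ _ _
  have Itm : ∀ k, Measurable (It k) := by
    intro k
    cases k with
    | zero => exact hg
    | succ k => rw [ItS]; exact MM_meas _ _
  set I := ∫⁻ x, g x ^ q * w x with hI
  have Itb : ∀ k, ∫⁻ x, It k x ^ q * w x ≤ K1 ^ k * I := by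
    intro k
    induction k with
    | zero => simp [It0, hI]
    | succ k ih =>
      rw [ItS]
      calc _ ≤ _ := H _ (Itm k)
        _ ≤ K1 * (K1 ^ k * I) := by
          refine mul_le_mul' ?_ ih
          exact le_self_add
        _ = _ := by ring
  refine ⟨fun x => ∑' k, t ^ k * It k x, ?_, ?_, ?_, ?_⟩
  · exact Measurable.tsum fun k => (Itm k).const_mul _
  · intro x
    refine le_trans ?_ (ENNReal.le_tsum 0)
    simp [It0]
  · have pt : ∀ x, (∑' k, t ^ k * It k x) ^ q ≤ ∑' k, (2 * s ^ k * It k x) ^ q := by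
      intro x
      rw [← ENNReal.le_rpow_inv_iff hq0]
      calc ∑' k, t ^ k * It k x = ∑' k, (2⁻¹ : ℝ≥0∞) ^ (k+1) * (2 * s ^ k * It k x) := by
            congr 1; ext k
            rw [ht, mul_pow, pow_succ]
            have : (2⁻¹ : ℝ≥0∞) * 2 = 1 := ENNReal.inv_mul_cancel (by simp) (by simp)
            calc _ = 2⁻¹ ^ k * (1 : ℝ≥0∞) * s ^ k * It k x := by ring
              _ = 2⁻¹ ^ k * ((2⁻¹ : ℝ≥0∞) * 2) * s ^ k * It k x := by rw [this]
              _ = _ := by ring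
        _ ≤ ∑' k : ℕ, (2⁻¹ : ℝ≥0∞) ^ (k+1) * (∑' k, (2 * s ^ k * It k x) ^ q) ^ q⁻¹ := by
            refine ENNReal.tsum_le_tsum fun k => mul_le_mul_right ?_ _
            rw [ENNReal.le_rpow_inv_iff hq0]
            exact ENNReal.le_tsum (f := fun k => (2 * s ^ k * It k x) ^ q) k
        _ = _ := by
            rw [ENNReal.tsum_mul_right, ENNReal.tsum_geometric_add_one]
            rw [ENNReal.one_sub_inv_two, inv_inv, ENNReal.inv_mul_cancel (by simp) (by simp),
              one_mul]
    calc ∫⁻ x, (∑' k, t ^ k * It k x) ^ q * w x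
        ≤ ∫⁻ x, ∑' k, (2 * s ^ k * It k x) ^ q * w x := by
          apply lintegral_mono; intro x
          simp only
          rw [ENNReal.tsum_mul_right]
          exact mul_le_mul_left (pt x) _
      _ = ∑' k, ∫⁻ x, (2 * s ^ k * It k x) ^ q * w x := by
          rw [lintegral_tsum]
          intro k
          exact ((((Itm k).const_mul _).pow_const q).mul h.hm).aemeasurable
      _ ≤ ∑' k : ℕ, 2 ^ q * (2⁻¹ : ℝ≥0∞) ^ k * I := by
          refine ENNReal.tsum_le_tsum fun k => ?_
          have e : ∀ x, (2 * s ^ k * It k x) ^ q * w x =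
              2 ^ q * ((2 * K1)⁻¹) ^ k * (It k x ^ q * w x) := by
            intro x
            rw [ENNReal.mul_rpow_of_nonneg _ _ hq0.le, ENNReal.mul_rpow_of_nonneg _ _ hq0.le,
              ← sq, ← ENNReal.rpow_natCast, ← ENNReal.rpow_natCast, ← ENNReal.rpow_mul,
              ← ENNReal.rpow_mul, mul_comm q]
            ring
          simp only [e]
          have hmm : Measurable (fun x => It k x ^ q * w x) := ((Itm k).pow_const q).mul h.hm
          rw [lintegral_const_mul _ hmm]
          calc _ ≤ 2 ^ q * ((2 * K1)⁻¹) ^ k * (K1 ^ k * I) := by gcongr; exact Itb k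
            _ = 2 ^ q * (2⁻¹ : ℝ≥0∞) ^ k * I * ((K1⁻¹ * K1) ^ k) := by
              rw [ENNReal.mul_inv (by simp) (by simp), mul_pow, mul_pow]; ring
            _ = _ := by rw [ENNReal.inv_mul_cancel K10 K1t]; simp
      _ = 2 ^ q * 2 * I := by
          rw [ENNReal.tsum_mul_right, ENNReal.tsum_mul_left, ENNReal.tsum_geometric,
            ENNReal.one_sub_inv_two, inv_inv]
      _ ≤ _ := by
          gcongr
          rw [add_assoc]; exact le_self_add
  · intro x r hr y hy
    obtain ⟨i, hi, hri⟩ := exists_cb x r hr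
    have hyi : y ∈ cb i := hi hy
    have V0 := cube_vol_ne_zero x r hr
    have Vt := cube_vol_ne_top x r hr
    have U0 : volume (cb (n := n) i) ≠ 0 := cube_vol_ne_zero _ _ (rad_pos i)
    have Ut : volume (cb (n := n) i) ≠ ⊤ := cube_vol_ne_top _ _ (rad_pos i)
    have hV : (volume (cubeSet x r))⁻¹ ≤ ENNReal.ofReal (2 ^ n) * (volume (cb (n := n) i))⁻¹ := by
      have := cube_vol_scale x (ctr i) r (rad i) 2 hr (rad_pos i) (by norm_num) hri
      change volume (cb i) ≤ _ at this
      rw [← div_eq_mul_inv, ENNReal.le_div_iff_mul_le (Or.inl U0) (Or.inl Ut), mul_comm,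
        ← div_eq_mul_inv]
      exact ENNReal.div_le_of_le_mul this
    calc (volume (cubeSet x r))⁻¹ * ∫⁻ z in cubeSet x r, ∑' k, t ^ k * It k z
        ≤ (ENNReal.ofReal (2 ^ n) * (volume (cb (n := n) i))⁻¹) *
            ∫⁻ z in cb i, ∑' k, t ^ k * It k z :=
          mul_le_mul' hV (lintegral_mono_set hi)
      _ = ENNReal.ofReal (2 ^ n) *
            ∑' k, t ^ k * ((volume (cb (n := n) i))⁻¹ * ∫⁻ z in cb i, It k z) := by
          rw [lintegral_tsum (fun k => ((Itm k).const_mul _).aemeasurable), mul_assoc,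
            ← ENNReal.tsum_mul_left]
          congr 2; ext k
          rw [lintegral_const_mul _ (Itm k)]; ring
      _ ≤ ENNReal.ofReal (2 ^ n) * ∑' k, t ^ k * It (k+1) y := by
          gcongr with k
          rw [ItS]
          exact le_MM _ _ i y hyi
      _ = ENNReal.ofReal (2 ^ n) * (t⁻¹ * ∑' k, t ^ (k+1) * It (k+1) y) := by
          rw [← ENNReal.tsum_mul_left (a := t⁻¹)]
          congr 1
          refine tsum_congr fun k => ?_
          rw [pow_succ', ← mul_assoc, ← mul_assoc, ENNReal.inv_mul_cancel t0 tt, one_mul]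
      _ ≤ ENNReal.ofReal (2 ^ n) * (t⁻¹ * ∑' k, t ^ k * It k y) := by
          exact mul_le_mul_right (mul_le_mul_right
            (ENNReal.tsum_comp_le_tsum_of_injective (add_left_injective 1)
              (fun k => t ^ k * It k y)) _) _
      _ = (ENNReal.ofReal (2 ^ n) * t⁻¹) * ∑' k, t ^ k * It k y := by ring
      _ ≤ _ := by
          gcongr
          rw [add_assoc, add_left_comm]; exact le_self_add

lemma aone_pos {n : ℕ} (K : ℝ≥0∞) (G : Eucl n → ℝ≥0∞) (hG : Measurable G)
    (h : AOne K G) (y : Eucl n) (hy : G y = 0) : ∀ᵐ x, G x = 0 := by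
  have hz : ∀ m : ℕ, ∀ᵐ x ∂(volume.restrict (cubeSet y ((m : ℝ) + 1))), G x = 0 := by
    intro m
    have hm : (0 : ℝ) < m + 1 := by positivity
    have := h y (m+1) hm y (fun i => by simpa using hm.le)
    rw [hy, mul_zero, le_zero_iff, mul_eq_zero] at this
    have := this.resolve_left (by simp [cube_vol_ne_top y _ hm])
    exact (lintegral_eq_zero_iff hG).1 this
  have hu : (⋃ m : ℕ, cubeSet y ((m : ℝ) + 1)) = Set.univ := by
    ext x
    simp only [Set.mem_iUnion, Set.mem_univ, iff_true]
    obtain ⟨m, hm⟩ := exists_nat_ge ‖y - x‖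
    refine ⟨m, fun i => ?_⟩
    have := PiLp.norm_apply_le (y - x) i
    simp only [PiLp.sub_apply, Real.norm_eq_abs] at this
    linarith
  have := (ae_restrict_iUnion_iff (μ := volume) (fun m : ℕ => cubeSet y ((m : ℝ) + 1))
    (fun x => G x = 0)).2 hz
  rwa [hu, Measure.restrict_univ] at this

lemma aone_ap {n : ℕ} (p : ℝ) (hp : 1 < p) (K1 K2 : ℝ≥0∞) (hK1 : K1 ≠ 0) (hK1t : K1 ≠ ⊤)
    (hK2 : K2 ≠ 0) (hK2t : K2 ≠ ⊤)
    (u1 u2 : Eucl n → ℝ≥0∞) (m1 : Measurable u1) (m2 : Measurable u2)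
    (h1 : AOne K1 u1) (h2 : AOne K2 u2)
    (p1 : ∀ᵐ x, 0 < u1 x ∧ u1 x < ⊤) (p2 : ∀ᵐ x, 0 < u2 x ∧ u2 x < ⊤) :
    apConst n p (fun x => u1 x ^ (-(p-1)) * u2 x) ≤ K1 ^ (p-1) * K2 := by
  have hp1 : 0 < p - 1 := by linarith
  refine iSup_le fun x => iSup_le fun r => iSup_le fun hr => ?_
  have g1 := h1 x r hr
  have g2 := h2 x r hr
  set Q := cubeSet x r with hQ
  have hQm : MeasurableSet Q := cube_meas x r
  set V := volume Q with hV
  set a1 := V⁻¹ * ∫⁻ z in Q, u1 z with ha1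
  set a2 := V⁻¹ * ∫⁻ z in Q, u2 z with ha2
  set c1 := K1⁻¹ * a1 with hc1
  set c2 := K2⁻¹ * a2 with hc2
  have e1 : a1 = K1 * c1 := by rw [hc1, ← mul_assoc, ENNReal.mul_inv_cancel hK1 hK1t, one_mul]
  have e2 : a2 = K2 * c2 := by rw [hc2, ← mul_assoc, ENNReal.mul_inv_cancel hK2 hK2t, one_mul]
  have b1 : ∀ y ∈ Q, c1 ≤ u1 y := fun y hy => by
    have := g1 y hy
    rw [e1] at this
    exact (ENNReal.mul_le_mul_iff_right hK1 hK1t).1 this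
  have b2 : ∀ y ∈ Q, c2 ≤ u2 y := fun y hy => by
    have := g2 y hy
    rw [e2] at this
    exact (ENNReal.mul_le_mul_iff_right hK2 hK2t).1 this
  have A : V⁻¹ * ∫⁻ y in Q, u1 y ^ (-(p-1)) * u2 y ≤ (c1 ^ (p-1))⁻¹ * a2 := by
    calc V⁻¹ * ∫⁻ y in Q, u1 y ^ (-(p-1)) * u2 y ≤ V⁻¹ * ∫⁻ y in Q, (c1 ^ (p-1))⁻¹ * u2 y := by
          refine mul_le_mul_right (setLIntegral_mono (m2.const_mul _) fun y hy => ?_) _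
          rw [ENNReal.rpow_neg]
          refine mul_le_mul_left ?_ _
          exact ENNReal.inv_le_inv.2 (ENNReal.rpow_le_rpow (b1 y hy) hp1.le)
      _ = _ := by rw [lintegral_const_mul _ m2, ha2]; ring
  have B : V⁻¹ * ∫⁻ y in Q, (u1 y ^ (-(p-1)) * u2 y) ^ (-(1/(p-1))) ≤
      (c2 ^ (1/(p-1)))⁻¹ * a1 := by
    calc V⁻¹ * ∫⁻ y in Q, (u1 y ^ (-(p-1)) * u2 y) ^ (-(1/(p-1)))
        ≤ V⁻¹ * ∫⁻ y in Q, (c2 ^ (1/(p-1)))⁻¹ * u1 y := by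
          refine mul_le_mul_right (lintegral_mono_ae ?_) _
          filter_upwards [ae_restrict_mem hQm, ae_restrict_of_ae p1, ae_restrict_of_ae p2]
            with y hy hy1 hy2
          rw [ENNReal.mul_rpow_of_ne_top
            (by simp [ENNReal.rpow_eq_top_iff, hy1.1.ne', hy1.2.ne]) hy2.2.ne,
            ← ENNReal.rpow_mul, show -(p-1) * -(1/(p-1)) = 1 by field_simp, ENNReal.rpow_one,
            mul_comm, ENNReal.rpow_neg]
          refine mul_le_mul_left ?_ _
          exact ENNReal.inv_le_inv.2 (ENNReal.rpow_le_rpow (b2 y hy) (by positivity))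
      _ = _ := by rw [lintegral_const_mul _ m1, ha1]; ring
  clear_value c1 c2
  calc _ ≤ ((c1 ^ (p-1))⁻¹ * a2) * ((c2 ^ (1/(p-1)))⁻¹ * a1) ^ (p-1) :=
        mul_le_mul' A (ENNReal.rpow_le_rpow B hp1.le)
    _ = (K1 ^ (p-1) * K2) * ((c1 ^ (p-1)) * (c1 ^ (p-1))⁻¹) * (c2 * c2⁻¹) := by
        rw [ENNReal.mul_rpow_of_nonneg _ _ hp1.le, ENNReal.inv_rpow, ← ENNReal.rpow_mul,
          one_div_mul_cancel hp1.ne', ENNReal.rpow_one, e1, e2,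
          ENNReal.mul_rpow_of_nonneg _ _ hp1.le]
        ring
    _ ≤ (K1 ^ (p-1) * K2) * 1 * 1 := by
        gcongr
        · exact ENNReal.mul_inv_le_one _
        · exact ENNReal.mul_inv_le_one _
    _ = _ := by simp

lemma fin_ae {n : ℕ} (q : ℝ) (hq : 0 < q) (w u : Eucl n → ℝ≥0∞) (hw : Measurable w)
    (h0 : ∀ x, w x ≠ 0) (hu : Measurable u) (h : ∫⁻ x, u x ^ q * w x ≠ ⊤) :
    ∀ᵐ x, u x < ⊤ := by
  filter_upwards [ae_lt_top ((hu.pow_const q).mul hw) h] with x hx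
  by_contra hc
  rw [not_lt, top_le_iff] at hc
  simp [hc, ENNReal.top_rpow_of_pos hq, ENNReal.top_mul (h0 x)] at hx

lemma holder_uv {n : ℕ} (p : ℝ) (hp : 1 < p) (F u1 u2 : Eucl n → ℝ≥0∞) (hF : Measurable F)
    (m1 : Measurable u1) (m2 : Measurable u2)
    (p1 : ∀ᵐ x, 0 < u1 x ∧ u1 x < ⊤) :
    ∫⁻ x, F x * u2 x ≤ (∫⁻ x, F x ^ p * (u1 x ^ (-(p-1)) * u2 x)) ^ (1/p) *
      (∫⁻ x, u1 x * u2 x) ^ (1 - 1/p) := by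
  have hp0 : 0 < p := by linarith
  have hp1 : 0 < p - 1 := by linarith
  have hc := Real.HolderConjugate.conjExponent hp
  have h := ENNReal.lintegral_mul_le_Lp_mul_Lq volume hc
    (f := fun y => F y * (u1 y ^ (-((p-1)/p)) * u2 y ^ (1/p)))
    (g := fun y => u1 y ^ ((p-1)/p) * u2 y ^ ((p-1)/p))
    (by fun_prop) (by fun_prop)
  have e1 : ∫⁻ x, F x * u2 x = ∫⁻ y, ((fun y => F y * (u1 y ^ (-((p-1)/p)) * u2 y ^ (1/p))) *
      (fun y => u1 y ^ ((p-1)/p) * u2 y ^ ((p-1)/p))) y := by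
    apply lintegral_congr_ae
    filter_upwards [p1] with y hy
    simp only [Pi.mul_apply]
    have a1 : u1 y ^ (-((p-1)/p)) * u1 y ^ ((p-1)/p) = 1 := by
      rw [← ENNReal.rpow_add _ _ hy.1.ne' hy.2.ne]; simp
    have a2 : u2 y ^ (1/p) * u2 y ^ ((p-1)/p) = u2 y := by
      rw [← ENNReal.rpow_add_of_nonneg _ _ (by positivity) (by positivity),
        show 1/p + (p-1)/p = 1 by field_simp; ring, ENNReal.rpow_one]
    calc F y * u2 y = F y * (1 * u2 y) := by rw [one_mul]
      _ = F y * ((u1 y ^ (-((p-1)/p)) * u1 y ^ ((p-1)/p)) *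
          (u2 y ^ (1/p) * u2 y ^ ((p-1)/p))) := by rw [a1, a2]
      _ = _ := by ring
  have e2 : ∀ y, (F y * (u1 y ^ (-((p-1)/p)) * u2 y ^ (1/p))) ^ p =
      F y ^ p * (u1 y ^ (-(p-1)) * u2 y) := fun y => by
    rw [ENNReal.mul_rpow_of_nonneg _ _ hp0.le, ENNReal.mul_rpow_of_nonneg _ _ hp0.le,
      ← ENNReal.rpow_mul, ← ENNReal.rpow_mul, one_div_mul_cancel hp0.ne', ENNReal.rpow_one]
    congr 3; field_simp
  have e3 : ∀ y, (u1 y ^ ((p-1)/p) * u2 y ^ ((p-1)/p)) ^ p.conjExponent = u1 y * u2 y := fun y => by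
    rw [← ENNReal.mul_rpow_of_nonneg _ _ (by positivity), ← ENNReal.rpow_mul]
    rw [show (p-1)/p * p.conjExponent = 1 by unfold Real.conjExponent; field_simp, ENNReal.rpow_one]
  rw [← e1] at h
  simp only [e2, e3] at h
  rwa [show 1 / p.conjExponent = 1 - 1/p by unfold Real.conjExponent; field_simp] at h

lemma holder_dual {n : ℕ} {q : ℝ} {w : Eucl n → ℝ≥0∞} (h : Good n q w)
    (u1 u2 : Eucl n → ℝ≥0∞) (m1 : Measurable u1) (m2 : Measurable u2) :
    ∫⁻ x, u1 x * u2 x ≤ (∫⁻ x, u1 x ^ q * w x) ^ (1/q) *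
      (∫⁻ x, u2 x ^ (q/(q-1)) * sg q w x) ^ (1/(q/(q-1))) := by
  have hq := h.hq
  have hq0 : 0 < q := by linarith
  have hq1 : 0 < q - 1 := by linarith
  have hc := Real.HolderConjugate.conjExponent hq
  have hm := h.hm
  have hh := ENNReal.lintegral_mul_le_Lp_mul_Lq volume hc
    (f := fun y => u1 y * w y ^ (1/q)) (g := fun y => u2 y * w y ^ (-(1/q)))
    (by fun_prop) (by fun_prop)
  have e1 : ∀ y, ((fun y => u1 y * w y ^ (1/q)) * (fun y => u2 y * w y ^ (-(1/q)))) y =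
      u1 y * u2 y := by
    intro y
    simp only [Pi.mul_apply]
    have a1 : w y ^ (1/q) * w y ^ (-(1/q)) = 1 := by
      rw [← ENNReal.rpow_add _ _ (h.h0 y) (h.ht y)]; simp
    calc _ = u1 y * u2 y * (w y ^ (1/q) * w y ^ (-(1/q))) := by ring
      _ = _ := by rw [a1, mul_one]
  have e2 : ∀ y, (u1 y * w y ^ (1/q)) ^ q = u1 y ^ q * w y := fun y => by
    rw [ENNReal.mul_rpow_of_nonneg _ _ hq0.le, ← ENNReal.rpow_mul, one_div_mul_cancel hq0.ne',
      ENNReal.rpow_one]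
  have e3 : ∀ y, (u2 y * w y ^ (-(1/q))) ^ q.conjExponent = u2 y ^ (q/(q-1)) * sg q w y :=
    fun y => by
    unfold Real.conjExponent sg
    rw [ENNReal.mul_rpow_of_nonneg _ _ (by positivity), ← ENNReal.rpow_mul]
    congr 2; field_simp
  simp only [e1, e2, e3] at hh
  exact hh

lemma core {n : ℕ} {q : ℝ} {w : Eucl n → ℝ≥0∞} (h : Good n q w) (p : ℝ) (hp : 1 < p)
    (N : ℝ → ℝ) (hN : MonotoneOn N (Set.Ici 1)) :
    ∃ C : ℝ≥0∞, C ≠ ⊤ ∧ ∀ f g : Eucl n → ℝ, memF n p N f g →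
      ¬ (∀ᵐ x, g x = 0) → wLp n q w g ≠ ⊤ →
      ∀ H : Eucl n → ℝ≥0∞, Measurable H → ∫⁻ x, H x ^ (q/(q-1)) * w x ≠ ⊤ →
      ∫⁻ x, (‖f x‖₊ : ℝ≥0∞) * (H x * w x) ≤
        C * wLp n q w g * (∫⁻ x, H x ^ (q/(q-1)) * w x) ^ (1/(q/(q-1))) := by
  have hq := h.hq
  have hq0 : 0 < q := by linarith
  have hq1 : 0 < q - 1 := by linarith
  have hp0 : 0 < p := by linarith
  have hp1 : 0 < p - 1 := by linarith
  have hp1' : 0 ≤ 1 - 1/p := by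
    rw [sub_nonneg, div_le_one hp0]; exact hp.le
  obtain ⟨K1, K1t, K11, H1⟩ := rdf h
  obtain ⟨K2, K2t, K21, H2⟩ := rdf h.dual
  have K10 : K1 ≠ 0 := (lt_of_lt_of_le zero_lt_one K11).ne'
  have K20 : K2 ≠ 0 := (lt_of_lt_of_le zero_lt_one K21).ne'
  set B := K1 ^ (p-1) * K2 with hB
  have Bt : B ≠ ⊤ := ENNReal.mul_ne_top (ENNReal.rpow_ne_top_of_nonneg hp1.le K1t) K2t
  set q' := q/(q-1) with hq'
  have q'0 : 0 < q' := by rw [hq']; positivity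
  refine ⟨ENNReal.ofReal (N B.toReal) * (K1 ^ (1/q) * K2 ^ (1/q')), ?_, ?_⟩
  · refine ENNReal.mul_ne_top ENNReal.ofReal_ne_top (ENNReal.mul_ne_top ?_ ?_)
    · exact ENNReal.rpow_ne_top_of_nonneg (by positivity) K1t
    · exact ENNReal.rpow_ne_top_of_nonneg (by positivity) K2t
  rintro f g ⟨hfm, hgm, hfg⟩ hg0 hgt H Hm Ht
  have hfm' : Measurable (fun x => (‖f x‖₊ : ℝ≥0∞)) := by fun_prop
  have hgm' : Measurable (fun x => (‖g x‖₊ : ℝ≥0∞)) := by fun_prop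
  by_cases hHz : ∀ᵐ x, H x * w x = 0
  · have : ∫⁻ x, (‖f x‖₊ : ℝ≥0∞) * (H x * w x) = 0 := by
      rw [← lintegral_zero (μ := (volume : Measure (Eucl n)))]
      apply lintegral_congr_ae
      filter_upwards [hHz] with x hx
      simp [hx]
    rw [this]; exact bot_le
  obtain ⟨u1, m1, l1, i1, a1⟩ := H1 _ hgm'
  obtain ⟨u2, m2, l2, i2, a2⟩ := H2 (fun x => H x * w x) (Hm.mul h.hm)
  have eH : ∀ x, (H x * w x) ^ q' * sg q w x = H x ^ q' * w x := by
    intro x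
    rw [ENNReal.mul_rpow_of_nonneg _ _ q'0.le, mul_assoc]
    congr 1
    unfold sg
    rw [← ENNReal.rpow_add _ _ (h.h0 x) (h.ht x)]
    nth_rewrite 2 [← ENNReal.rpow_one (w x)]
    congr 1; rw [hq']; field_simp; ring
  simp only [eH] at i2
  have hgt' : ∫⁻ x, (‖g x‖₊ : ℝ≥0∞) ^ q * w x ≠ ⊤ := by
    intro hc
    apply hgt
    unfold wLp wLpE
    rw [hc, ENNReal.top_rpow_of_pos (by positivity)]
  have u1f := fin_ae q hq0 w u1 h.hm h.h0 m1
    (ne_top_of_le_ne_top (ENNReal.mul_ne_top K1t hgt') i1)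
  have u2f := fin_ae q' q'0 (sg q w) u2 (sg_meas q w h.hm) (sg_ne_zero q w h.h0 h.ht) m2
    (ne_top_of_le_ne_top (ENNReal.mul_ne_top K2t Ht) i2)
  have u10 : ∀ x, u1 x ≠ 0 := by
    intro y hy
    apply hg0
    filter_upwards [aone_pos K1 u1 m1 a1 y hy] with x hx
    have := l1 x
    rw [hx] at this
    simpa using this
  have u20 : ∀ x, u2 x ≠ 0 := by
    intro y hy
    apply hHz
    filter_upwards [aone_pos K2 u2 m2 a2 y hy] with x hx
    have := l2 x
    rw [hx] at this
    simpa using this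
  have p1 : ∀ᵐ x, 0 < u1 x ∧ u1 x < ⊤ := by
    filter_upwards [u1f] with x hx using ⟨pos_iff_ne_zero.2 (u10 x), hx⟩
  have p2 : ∀ᵐ x, 0 < u2 x ∧ u2 x < ⊤ := by
    filter_upwards [u2f] with x hx using ⟨pos_iff_ne_zero.2 (u20 x), hx⟩
  set v : Eucl n → ℝ≥0∞ := fun x => u1 x ^ (-(p-1)) * u2 x with hv
  have vm : Measurable v := by rw [hv]; fun_prop
  have vp : ∀ᵐ x, 0 < v x ∧ v x < ⊤ := by
    filter_upwards [p1, p2] with x h1 h2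
    constructor
    · refine ENNReal.mul_pos ?_ h2.1.ne'
      simp [ENNReal.rpow_eq_zero_iff, h1.1.ne', h1.2.ne]
    · refine ENNReal.mul_lt_top ?_ h2.2
      rw [lt_top_iff_ne_top]
      simp [ENNReal.rpow_eq_top_iff, h1.1.ne', h1.2.ne]
  have vA : apConst n p v ≤ B := aone_ap p hp K1 K2 K10 K1t K20 K2t u1 u2 m1 m2 a1 a2 p1 p2
  have vMem : MemAp n p v := ⟨⟨vm, vp⟩, vA.trans_lt (lt_top_iff_ne_top.2 Bt)⟩
  have v1 : 1 ≤ apConst n p v := one_le_ap p hp v vm vp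
  have vAt : apConst n p v ≠ ⊤ := ne_top_of_le_ne_top Bt vA
  have hNle : N (apConst n p v).toReal ≤ N B.toReal := by
    have h1 : 1 ≤ (apConst n p v).toReal := by
      have := ENNReal.toReal_mono vAt v1
      simpa using this
    have h2 : (apConst n p v).toReal ≤ B.toReal := ENNReal.toReal_mono Bt vA
    exact hN h1 (h1.trans h2) h2
  set T := ∫⁻ x, u1 x * u2 x with hT
  have gT : wLp n p v g ≤ T ^ (1/p) := by
    unfold wLp wLpE
    refine ENNReal.rpow_le_rpow (lintegral_mono_ae ?_) (by positivity)
    filter_upwards [p1] with x hx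
    calc (‖g x‖₊ : ℝ≥0∞) ^ p * v x ≤ u1 x ^ p * v x := by
          gcongr; exact l1 x
      _ = (u1 x ^ p * u1 x ^ (-(p-1))) * u2 x := by rw [hv, mul_assoc]
      _ = u1 x * u2 x := by
          rw [← ENNReal.rpow_add _ _ hx.1.ne' hx.2.ne, show p + -(p-1) = 1 by ring,
            ENNReal.rpow_one]
  calc ∫⁻ x, (‖f x‖₊ : ℝ≥0∞) * (H x * w x) ≤ ∫⁻ x, (‖f x‖₊ : ℝ≥0∞) * u2 x := by
        apply lintegral_mono; intro x
        exact mul_le_mul_right (l2 x) _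
    _ ≤ wLp n p v f * T ^ (1 - 1/p) := holder_uv p hp _ u1 u2 hfm' m1 m2 p1
    _ ≤ (ENNReal.ofReal (N B.toReal) * T ^ (1/p)) * T ^ (1 - 1/p) := by
        gcongr
        exact (hfg v vMem).trans (mul_le_mul' (ENNReal.ofReal_le_ofReal hNle) gT)
    _ = ENNReal.ofReal (N B.toReal) * T := by
        rw [mul_assoc, ← ENNReal.rpow_add_of_nonneg _ _ (by positivity) hp1']
        simp
    _ ≤ ENNReal.ofReal (N B.toReal) * ((∫⁻ x, u1 x ^ q * w x) ^ (1/q) *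
          (∫⁻ x, u2 x ^ q' * sg q w x) ^ (1/q')) := by
        exact mul_le_mul_right (holder_dual h u1 u2 m1 m2) _
    _ ≤ ENNReal.ofReal (N B.toReal) * ((K1 * ∫⁻ x, (‖g x‖₊ : ℝ≥0∞) ^ q * w x) ^ (1/q) *
          (K2 * ∫⁻ x, H x ^ q' * w x) ^ (1/q')) := by
        gcongr
    _ = _ := by
        rw [ENNReal.mul_rpow_of_nonneg _ _ (by positivity),
          ENNReal.mul_rpow_of_nonneg _ _ (by positivity)]
        unfold wLp wLpE
        ring

lemma ap_one {n : ℕ} (p : ℝ) (hp : 1 < p) : MemAp n p (fun _ => 1) := by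
  refine ⟨⟨measurable_const, ae_of_all _ fun x => by simp⟩, ?_⟩
  refine lt_of_le_of_lt ?_ (ENNReal.one_lt_top)
  refine iSup_le fun x => iSup_le fun r => iSup_le fun hr => ?_
  simp only [ENNReal.one_rpow, lintegral_const, Measure.restrict_apply, MeasurableSet.univ,
    Set.univ_inter, one_mul]
  rw [ENNReal.inv_mul_cancel (cube_vol_ne_zero x r hr) (cube_vol_ne_top x r hr)]
  simp

lemma zero_case {n : ℕ} (q : ℝ) (hq : 1 < q) (w : Eucl n → ℝ≥0∞) (p : ℝ) (hp : 1 < p) (N : ℝ → ℝ)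
    (f g : Eucl n → ℝ) (hfg : memF n p N f g) (hg : ∀ᵐ x, g x = 0) : wLp n q w f = 0 := by
  have hp0 : 0 < p := by linarith
  have hq0 : 0 < q := by linarith
  have h := hfg.2.2 _ (ap_one p hp)
  have hgz : wLp n p (fun _ => 1) g = 0 := by
    unfold wLp wLpE
    have : ∫⁻ x, (‖g x‖₊ : ℝ≥0∞) ^ p * 1 = 0 := by
      rw [← lintegral_zero (μ := (volume : Measure (Eucl n)))]
      apply lintegral_congr_ae
      filter_upwards [hg] with x hx
      simp [hx, hp0]
    rw [this, ENNReal.zero_rpow_of_pos (by positivity)]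
  rw [hgz, mul_zero, le_zero_iff] at h
  unfold wLp wLpE at h ⊢
  have hfm := hfg.1
  rw [ENNReal.rpow_eq_zero_iff_of_pos (by positivity), lintegral_eq_zero_iff (by fun_prop)] at h
  have : ∫⁻ x, (‖f x‖₊ : ℝ≥0∞) ^ q * w x = 0 := by
    rw [← lintegral_zero (μ := (volume : Measure (Eucl n)))]
    apply lintegral_congr_ae
    filter_upwards [h] with x hx
    simp only [mul_one, Pi.zero_apply, ENNReal.rpow_eq_zero_iff_of_pos hp0] at hx
    simp [hx, hq0]
  rw [this, ENNReal.zero_rpow_of_pos (by positivity)]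

lemma main_good {n : ℕ} {q : ℝ} {w : Eucl n → ℝ≥0∞} (h : Good n q w) (p : ℝ) (hp : 1 < p)
    (N : ℝ → ℝ) (hN : MonotoneOn N (Set.Ici 1)) :
    ∃ C : ℝ, 0 < C ∧ ∀ f g : Eucl n → ℝ, memF n p N f g →
      wLp n q w f ≤ ENNReal.ofReal C * wLp n q w g := by
  have hq := h.hq
  have hq0 : 0 < q := by linarith
  have hq1 : 0 < q - 1 := by linarith
  obtain ⟨C, Ct, HC⟩ := core h p hp N hN
  refine ⟨C.toReal + 1, by positivity, fun f g hfg => ?_⟩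
  have hCle : C ≤ ENNReal.ofReal (C.toReal + 1) := by
    rw [ENNReal.ofReal_add (by positivity) (by norm_num), ENNReal.ofReal_toReal Ct]
    exact le_self_add
  by_cases hg : ∀ᵐ x, g x = 0
  · rw [zero_case q hq w p hp N f g hfg hg]; exact bot_le
  by_cases hgt : wLp n q w g = ⊤
  · rw [hgt, ENNReal.mul_top]
    · exact le_top
    · simp only [ne_eq, ENNReal.ofReal_eq_zero, not_le]; positivity
  refine le_trans ?_ (mul_le_mul_left hCle _)
  set A := C * wLp n q w g with hA
  have hfm := hfg.1
  have hfm' : Measurable (fun x => (‖f x‖₊ : ℝ≥0∞)) := by fun_prop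
  have hwm := h.hm
  set F : Eucl n → ℝ≥0∞ := fun x => (‖f x‖₊ : ℝ≥0∞) with hF
  let S : ℕ → Set (Eucl n) := fun k => {x | F x ≤ k ∧ w x ≤ k ∧ ‖x‖ ≤ k}
  have Sm : ∀ k, MeasurableSet (S k) := fun k =>
    (measurableSet_le hfm' measurable_const).inter
      ((measurableSet_le hwm measurable_const).inter
        (measurableSet_le measurable_norm measurable_const))
  have Smono : Monotone S := by
    intro a b hab x hx
    have h1 : (a : ℝ≥0∞) ≤ b := by exact_mod_cast hab
    have h2 : (a : ℝ) ≤ b := by exact_mod_cast hab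
    exact ⟨hx.1.trans h1, hx.2.1.trans h1, hx.2.2.trans h2⟩
  have Su : ⋃ k, S k = Set.univ := by
    ext x
    simp only [Set.mem_iUnion, Set.mem_univ, iff_true]
    obtain ⟨a, ha⟩ := ENNReal.exists_nat_gt (show F x ≠ ⊤ by simp [hF])
    obtain ⟨b, hb⟩ := ENNReal.exists_nat_gt (h.ht x)
    obtain ⟨c, hc⟩ := exists_nat_ge ‖x‖
    refine ⟨a + b + c, ?_, ?_, ?_⟩
    · refine ha.le.trans ?_
      exact_mod_cast (by omega : a ≤ a + b + c)
    · refine hb.le.trans ?_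
      exact_mod_cast (by omega : b ≤ a + b + c)
    · refine hc.trans ?_
      exact_mod_cast (by omega : c ≤ a + b + c)
  have bound : ∀ k, ∫⁻ x in S k, F x ^ q * w x ≤ A ^ q := by
    intro k
    set J := ∫⁻ x in S k, F x ^ q * w x with hJ
    have Jt : J ≠ ⊤ := by
      have : J ≤ ∫⁻ x in S k, ((k : ℝ≥0∞) ^ q * k) := by
        refine setLIntegral_mono measurable_const fun x hx => ?_
        exact mul_le_mul' (ENNReal.rpow_le_rpow hx.1 hq0.le) hx.2.1
      refine ne_top_of_le_ne_top ?_ this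
      rw [setLIntegral_const]
      refine ENNReal.mul_ne_top (ENNReal.mul_ne_top
        (ENNReal.rpow_ne_top_of_nonneg hq0.le (by simp)) (by simp)) ?_
      refine ne_top_of_le_ne_top (measure_closedBall_lt_top (x := (0 : Eucl n)) (r := k)).ne
        (measure_mono fun x hx => ?_)
      simpa using hx.2.2
    set H : Eucl n → ℝ≥0∞ := (S k).indicator (fun x => F x ^ (q-1)) with hH
    have Hm : Measurable H := (hfm'.pow_const _).indicator (Sm k)
    have e1 : ∫⁻ x, H x ^ (q/(q-1)) * w x = J := by
      rw [hJ, ← lintegral_indicator (Sm k)]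
      congr 1; ext x
      by_cases hx : x ∈ S k
      · rw [hH]
        simp only [Set.indicator_of_mem hx]
        rw [← ENNReal.rpow_mul, show (q-1) * (q/(q-1)) = q by field_simp]
      · rw [hH]
        simp only [Set.indicator_of_notMem hx]
        rw [ENNReal.zero_rpow_of_pos (by positivity), zero_mul]
    have e2 : ∫⁻ x, F x * (H x * w x) = J := by
      rw [hJ, ← lintegral_indicator (Sm k)]
      congr 1; ext x
      by_cases hx : x ∈ S k
      · rw [hH]
        simp only [Set.indicator_of_mem hx]
        rw [← mul_assoc]
        congr 1
        nth_rewrite 1 [← ENNReal.rpow_one (F x)]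
        rw [← ENNReal.rpow_add_of_nonneg _ _ (by norm_num) hq1.le]
        congr 1; ring
      · rw [hH]
        simp only [Set.indicator_of_notMem hx]
        simp
    have key := HC f g hfg hg hgt H Hm (by rw [e1]; exact Jt)
    rw [e1] at key
    change ∫⁻ x, F x * (H x * w x) ≤ _ at key
    rw [e2] at key
    by_cases J0 : J = 0
    · rw [J0]; exact bot_le
    have e3 : J = J ^ (1/q) * J ^ (1/(q/(q-1))) := by
      rw [← ENNReal.rpow_add _ _ J0 Jt, show 1/q + 1/(q/(q-1)) = 1 by field_simp; ring,
        ENNReal.rpow_one]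
    have e4 : J ^ (1/q) ≤ A := by
      have z0 : J ^ (1/(q/(q-1))) ≠ 0 := by
        simp [ENNReal.rpow_eq_zero_iff, J0, Jt]
      have zt : J ^ (1/(q/(q-1))) ≠ ⊤ := ENNReal.rpow_ne_top_of_nonneg (by positivity) Jt
      refine (ENNReal.mul_le_mul_iff_left z0 zt).1 ?_
      rw [← e3]; exact key
    calc J = (J ^ (1/q)) ^ q := by
          rw [← ENNReal.rpow_mul, one_div_mul_cancel hq0.ne', ENNReal.rpow_one]
      _ ≤ A ^ q := ENNReal.rpow_le_rpow e4 hq0.le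
  have tot : ∫⁻ x, F x ^ q * w x ≤ A ^ q := by
    rw [← setLIntegral_univ, ← Su, setLIntegral_iUnion_of_directed _ Smono.directed_le]
    exact iSup_le bound
  unfold wLp wLpE
  calc _ ≤ (A ^ q) ^ (1/q) := ENNReal.rpow_le_rpow tot (by positivity)
    _ = A := by rw [← ENNReal.rpow_mul, mul_one_div_cancel hq0.ne', ENNReal.rpow_one]

end Extrap

/-- **Extrapolation in weighted Lebesgue spaces `L^q(w)`, `w ∈ A_q`.** -/
theorem extrapolation_weighted_Lq (n : ℕ) (hn : 1 ≤ n) (q : ℝ) (hq : 1 < q)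
    (w : Eucl n → ℝ≥0∞) (hw : MemAp n q w)
    (p : ℝ) (hp : 1 < p)
    (N : ℝ → ℝ) (hN : MonotoneOn N (Set.Ici 1)) (hNpos : ∀ t, 1 ≤ t → 0 < N t) :
    ∃ C : ℝ, 0 < C ∧ ∀ f g : Eucl n → ℝ, memF n p N f g →
      wLp n q w f ≤ ENNReal.ofReal C * wLp n q w g := by
  
  classical
  let w' : Eucl n → ℝ≥0∞ := fun x => if 0 < w x ∧ w x < ⊤ then w x else 1
  have hae : w' =ᵐ[volume] w := by
    filter_upwards [hw.1.2] with x hx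
    simp only [w', if_pos hx]
  have hG : Extrap.Good n q w' := by
    refine ⟨hq, ?_, ?_, ?_, ?_⟩
    · exact Measurable.ite ((measurableSet_lt measurable_const hw.1.1).inter
        (measurableSet_lt hw.1.1 measurable_const)) hw.1.1 measurable_const
    · intro x
      by_cases hx : 0 < w x ∧ w x < ⊤
      · simp only [w', if_pos hx]; exact hx.1.ne'
      · simp [w', if_neg hx]
    · intro x
      by_cases hx : 0 < w x ∧ w x < ⊤
      · simp only [w', if_pos hx]; exact hx.2.ne
      · simp [w', if_neg hx]
    · have : apConst n q w' = apConst n q w := by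
        have i1 : ∀ (x : Eucl n) (r : ℝ), ∫⁻ y in cubeSet x r, w' y = ∫⁻ y in cubeSet x r, w y :=
          fun x r => lintegral_congr_ae (ae_restrict_of_ae hae)
        have i2 : ∀ (x : Eucl n) (r : ℝ), ∫⁻ y in cubeSet x r, w' y ^ (-(1/(q-1))) =
            ∫⁻ y in cubeSet x r, w y ^ (-(1/(q-1))) := by
          intro x r
          apply lintegral_congr_ae
          filter_upwards [ae_restrict_of_ae hae] with y hy
          rw [hy]
        unfold apConst
        simp only [i1, i2]
      rw [this]; exact hw.2
  have hl : ∀ f : Eucl n → ℝ, wLp n q w f = wLp n q w' f := by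
    intro f
    unfold wLp wLpE
    congr 1
    apply lintegral_congr_ae
    filter_upwards [hae] with y hy
    rw [hy]
  simp only [hl]
  exact Extrap.main_good hG p hp N hN
end
end

section
/- Let n ≥ 1, let 1 < q < ∞, let 1 < p < ∞, and let N : [1,∞) → (0,∞) be increasing. Then there exists a constant C > 0 such that ‖f‖_{L^{q,∞}} ≤ C‖g‖_{L^{q,∞}} for every pair (f,g) ∈ F(p,N), where ‖h‖_{L^{q,∞}} := sup_{λ>0} λ·|{x ∈ ℝⁿ : |h(x)| > λ}|^{1/q} is the weak L^q quasi-norm. -/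
open MeasureTheory ENNReal NNReal Filter Topology

noncomputable section

/-- The weak-`L^q` quasi-norm `sup_{λ>0} λ |{|h| > λ}|^{1/q}`. -/
def wkLq (n : ℕ) (q : ℝ) (h : Eucl n → ℝ) : ℝ≥0∞ :=
  ⨆ (l : ℝ) (_ : 0 < l),
    ENNReal.ofReal l * (volume {x : Eucl n | l < |h x|}) ^ (1/q)


open Metric Set

section Aux

variable {n : ℕ}



lemma vol_ball_pos (x : Eucl n) {r : ℝ} (hr : 0 < r) : volume (ball x r) ≠ 0 :=
  (measure_ball_pos volume x hr).ne'

lemma vol_ball_top (x : Eucl n) (r : ℝ) : volume (ball x r) ≠ ⊤ := measure_ball_lt_top.ne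

lemma vol_ball_mul (x y : Eucl n) {r c : ℝ} (hc : 0 < c) :
    volume (ball x (c * r)) = ENNReal.ofReal c ^ n * volume (ball y r) := by
  rw [Measure.addHaar_ball_mul_of_pos volume x hc, Measure.addHaar_ball_center volume y,
    ENNReal.ofReal_pow hc.le]
  simp

lemma vol_closedBall_eq (x : Eucl n) {r : ℝ} (hr : 0 < r) :
    volume (closedBall x r) = volume (ball x r) := by
  rw [Measure.addHaar_closedBall volume x hr.le, Measure.addHaar_ball_of_pos volume x hr]

/-- uncentred maximal function over open Euclidean balls -/
def Mx (φ : Eucl n → ℝ≥0∞) (x : Eucl n) : ℝ≥0∞ :=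
  ⨆ (z : Eucl n) (r : ℝ) (_ : 0 < r),
    (ball z r).indicator (fun _ => (∫⁻ y in ball z r, φ y) / volume (ball z r)) x

lemma measurable_Mx (φ : Eucl n → ℝ≥0∞) : Measurable (Mx φ) := by
  apply LowerSemicontinuous.measurable
  unfold Mx
  refine lowerSemicontinuous_iSup fun z => lowerSemicontinuous_biSup fun r hr => ?_
  exact isOpen_ball.lowerSemicontinuous_indicator (zero_le)

lemma le_Mx (φ : Eucl n → ℝ≥0∞) {x z : Eucl n} {r : ℝ} (hr : 0 < r) (hx : x ∈ ball z r) :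
    (∫⁻ y in ball z r, φ y) / volume (ball z r) ≤ Mx φ x := by
  unfold Mx
  refine le_iSup_of_le z (le_iSup_of_le r (le_iSup_of_le hr ?_))
  rw [indicator_of_mem hx]

lemma setLIntegral_le_Mx (φ : Eucl n → ℝ≥0∞) {x z : Eucl n} {r : ℝ} (hr : 0 < r)
    (hx : x ∈ ball z r) :
    (∫⁻ y in ball z r, φ y) ≤ Mx φ x * volume (ball z r) := by
  have := le_Mx φ hr hx
  rwa [ENNReal.div_le_iff (vol_ball_pos z hr) (vol_ball_top z r)] at this

lemma Mx_le (φ : Eucl n → ℝ≥0∞) {x : Eucl n} {c : ℝ≥0∞}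
    (h : ∀ z r, 0 < r → x ∈ ball z r → (∫⁻ y in ball z r, φ y) / volume (ball z r) ≤ c) :
    Mx φ x ≤ c := by
  unfold Mx
  refine iSup_le fun z => iSup_le fun r => iSup_le fun hr => ?_
  by_cases hx : x ∈ ball z r
  · rw [indicator_of_mem hx]; exact h z r hr hx
  · rw [indicator_of_notMem hx]; exact zero_le

lemma lt_Mx (φ : Eucl n → ℝ≥0∞) {x : Eucl n} {c : ℝ≥0∞} (h : c < Mx φ x) :
    ∃ z r, 0 < r ∧ x ∈ ball z r ∧ c * volume (ball z r) ≤ ∫⁻ y in ball z r, φ y := by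
  by_contra! hcon
  refine absurd h (not_lt.2 (Mx_le φ fun z r hr hx => ?_))
  rw [ENNReal.div_le_iff (vol_ball_pos z hr) (vol_ball_top z r)]
  exact (hcon z r hr hx).le

lemma Mx_mono {φ ψ : Eucl n → ℝ≥0∞} (h : φ ≤ ψ) : Mx φ ≤ Mx ψ := by
  intro x
  refine Mx_le φ fun z r hr hx => le_trans ?_ (le_Mx ψ hr hx)
  gcongr
  exact h _

lemma Mx_weak (hn : 1 ≤ n) (φ : Eucl n → ℝ≥0∞) (t : ℝ≥0∞) :
    t * volume {x | t < Mx φ x} ≤ 5 ^ n * ∫⁻ y, φ y := by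
  rcases eq_or_ne t 0 with rfl | ht0
  · simp
  rcases eq_or_ne t ⊤ with rfl | htt
  · simp
  rcases eq_or_ne (∫⁻ y, φ y) ⊤ with hI | hI
  · rw [hI, ENNReal.mul_top (by positivity)]; exact le_top
  set S := {x | t < Mx φ x} with hS
  have key : ∀ x : Eucl n, ∃ z r, x ∈ S → 0 < r ∧ x ∈ ball z r ∧
      t * volume (ball z r) ≤ ∫⁻ y in ball z r, φ y := by
    intro x
    by_cases hx : x ∈ S
    · obtain ⟨z, r, h⟩ := lt_Mx φ hx
      exact ⟨z, r, fun _ => h⟩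
    · exact ⟨0, 0, fun h => absurd h hx⟩
  choose z r hzr using key
  -- radius bound
  set c : ℝ≥0∞ := (∫⁻ y, φ y) / (t * volume (ball (0 : Eucl n) 1)) with hc
  have hden0 : t * volume (ball (0 : Eucl n) 1) ≠ 0 :=
    mul_ne_zero ht0 (vol_ball_pos 0 one_pos)
  have hdent : t * volume (ball (0 : Eucl n) 1) ≠ ⊤ := ENNReal.mul_ne_top htt (vol_ball_top 0 1)
  have hct : c ≠ ⊤ := ENNReal.div_ne_top hI hden0
  have hR : ∀ x ∈ S, r x ≤ max 1 c.toReal := by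
    intro x hx
    obtain ⟨hr, -, h⟩ := hzr x hx
    by_cases h1 : r x ≤ 1
    · exact le_max_of_le_left h1
    push Not at h1
    refine le_max_of_le_right ?_
    have h2 : ENNReal.ofReal (r x) ^ n ≤ c := by
      rw [hc, ENNReal.le_div_iff_mul_le (Or.inl hden0) (Or.inl hdent)]
      have := vol_ball_mul (z x) (0 : Eucl n) (r := 1) hr
      rw [mul_one] at this
      calc _ = t * volume (ball (z x) (r x)) := by rw [this]; ring
        _ ≤ ∫⁻ y in ball (z x) (r x), φ y := h
        _ ≤ _ := setLIntegral_le_lintegral _ _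
    have h3 : ENNReal.ofReal (r x) ≤ c := by
      refine le_trans ?_ h2
      refine le_self_pow₀ ?_ (by omega)
      rw [ENNReal.one_le_ofReal]; exact h1.le
    exact (ENNReal.ofReal_le_iff_le_toReal hct).1 h3
  obtain ⟨u, huS, hud, huc⟩ := Vitali.exists_disjoint_subfamily_covering_enlargement_closedBall
    S z r _ hR 5 (by norm_num)
  have hucount : u.Countable := by
    refine hud.countable_of_nonempty_interior fun i hi => ?_
    have : (ball (z i) (r i)).Nonempty := ⟨i, (hzr i (huS hi)).2.1⟩
    exact this.mono ball_subset_interior_closedBall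
  have hcov : S ⊆ ⋃ b ∈ u, closedBall (z b) (5 * r b) := by
    intro x hx
    obtain ⟨b, hb, hsub⟩ := huc x hx
    exact mem_biUnion hb (hsub (ball_subset_closedBall (hzr x hx).2.1))
  have hud' : u.PairwiseDisjoint fun b => ball (z b) (r b) :=
    hud.mono fun _ => ball_subset_closedBall
  haveI := hucount.to_subtype
  calc t * volume S ≤ t * ∑' b : u, volume (closedBall (z b) (5 * r b)) := by
        gcongr
        exact (measure_mono hcov).trans (measure_biUnion_le volume hucount _)
    _ = ∑' b : u, t * (5 ^ n * volume (ball (z b) (r b))) := by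
        rw [← ENNReal.tsum_mul_left]
        congr 1; ext b
        have hr := (hzr b (huS b.2)).1
        rw [vol_closedBall_eq _ (by positivity), vol_ball_mul _ (z b) (by norm_num)]
        simp
    _ ≤ ∑' b : u, 5 ^ n * ∫⁻ y in ball (z b) (r b), φ y := by
        refine ENNReal.tsum_le_tsum fun b => ?_
        have := (hzr b (huS b.2)).2.2
        calc _ = 5 ^ n * (t * volume (ball (z b) (r b))) := by ring
          _ ≤ _ := by gcongr
    _ = 5 ^ n * ∫⁻ y in ⋃ b ∈ u, ball (z b) (r b), φ y := by
        rw [ENNReal.tsum_mul_left, lintegral_biUnion hucount (fun _ _ => measurableSet_ball) hud']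
    _ ≤ _ := by
        gcongr
        exact Measure.restrict_le_self

lemma ae_le_Mx_aux {φ : Eucl n → ℝ≥0∞} (hφ : Measurable φ) (hI : ∫⁻ y, φ y ≠ ⊤) :
    ∀ᵐ x, φ x ≤ Mx φ x := by
  filter_upwards [(Besicovitch.vitaliFamily (volume : Measure (Eucl n))).ae_tendsto_lintegral_div'
    hφ hI] with x hx
  have h2 := hx.comp (Besicovitch.tendsto_filterAt volume x)
  refine le_of_tendsto h2 ?_
  filter_upwards [self_mem_nhdsWithin] with r hr
  have hr : 0 < r := hr
  have : (ball x r : Set (Eucl n)) =ᵐ[volume] closedBall x r :=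
    ae_eq_of_subset_of_measure_ge ball_subset_closedBall (vol_closedBall_eq x hr).le
      measurableSet_ball.nullMeasurableSet measure_closedBall_lt_top.ne
  simp only [Function.comp]
  rw [vol_closedBall_eq x hr, ← Measure.restrict_congr_set this]
  exact le_Mx φ hr (mem_ball_self hr)

lemma ae_le_Mx {φ : Eucl n → ℝ≥0∞} (hφ : Measurable φ) :
    ∀ᵐ x, φ x ≤ Mx φ x := by
  have h : ∀ k : ℕ, ∀ᵐ x, (ball (0 : Eucl n) k).indicator (fun x => min (φ x) k) x ≤ Mx φ x := by
    intro k
    have hm : Measurable ((ball (0 : Eucl n) k).indicator (fun x => min (φ x) k)) :=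
      (hφ.min measurable_const).indicator measurableSet_ball
    have hI : ∫⁻ y, (ball (0 : Eucl n) k).indicator (fun x => min (φ x) k) y ≠ ⊤ := by
      rw [lintegral_indicator measurableSet_ball]
      refine ne_top_of_le_ne_top ?_ (lintegral_mono (g := fun _ => (k : ℝ≥0∞)) fun x => min_le_right _ _)
      rw [setLIntegral_const]
      exact ENNReal.mul_ne_top (by simp) (vol_ball_top _ _)
    filter_upwards [ae_le_Mx_aux hm hI] with x hx
    refine hx.trans (Mx_mono ?_ x)
    intro y
    refine indicator_le (fun z _ => min_le_left _ _) y
  filter_upwards [ae_all_iff.2 h] with x hx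
  refine le_of_forall_lt fun c hc => ?_
  obtain ⟨k1, hk1⟩ := exists_nat_gt ‖x‖
  obtain ⟨k2, hk2⟩ := ENNReal.exists_nat_gt (hc.ne_top)
  refine lt_of_lt_of_le ?_ (hx (max k1 k2))
  rw [indicator_of_mem]
  · refine lt_min hc (hk2.trans_le ?_)
    simp
  · rw [mem_ball_zero_iff]
    refine hk1.trans_le ?_
    simp

lemma Mx_ne_zero {φ : Eucl n → ℝ≥0∞} (h : ∫⁻ y, φ y ≠ 0) (x : Eucl n) : Mx φ x ≠ 0 := by
  intro h0
  apply h
  have : ∀ k : ℕ, ∫⁻ y in ball x (k + 1), φ y = 0 := by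
    intro k
    have := setLIntegral_le_Mx φ (x := x) (z := x) (r := (k : ℝ) + 1) (by positivity)
      (mem_ball_self (by positivity))
    rwa [h0, zero_mul, nonpos_iff_eq_zero] at this
  have hU : (⋃ k : ℕ, ball x ((k : ℝ) + 1)) = univ := by
    refine eq_univ_of_forall fun y => mem_iUnion.2 ?_
    obtain ⟨k, hk⟩ := exists_nat_gt (dist y x)
    exact ⟨k, by rw [mem_ball]; linarith⟩
  rw [← setLIntegral_univ, ← hU]
  refine nonpos_iff_eq_zero.1 ((lintegral_iUnion_le _ _).trans ?_)
  simp [this]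



lemma two_pow_rpow (k : ℕ) (s : ℝ) : ((2 : ℝ≥0∞) ^ k) ^ s = ((2 : ℝ≥0∞) ^ s) ^ k := by
  rw [← ENNReal.rpow_natCast, ← ENNReal.rpow_mul, ← ENNReal.rpow_natCast, ← ENNReal.rpow_mul,
    mul_comm]

lemma tsum_geom_ne_top {ρ : ℝ≥0∞} (h : ρ < 1) : ∑' k : ℕ, ρ ^ k ≠ ⊤ := by
  rw [ENNReal.tsum_geometric]
  simpa [tsub_eq_zero_iff_le] using h

lemma rpow_ne_zero_pos {x : ℝ≥0∞} (h : x ≠ 0) {s : ℝ} (hs : 0 ≤ s) : x ^ s ≠ 0 := by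
  intro h0
  rcases ENNReal.rpow_eq_zero_iff.1 h0 with h1 | h1
  · exact h h1.1
  · linarith [h1.2]

lemma two_rpow_lt_one {s : ℝ} (hs : s < 0) : (2 : ℝ≥0∞) ^ s < 1 :=
  ENNReal.rpow_lt_one_of_one_lt_of_neg (by norm_num) hs

/-- dyadic pointwise bound -/
lemma dyadic_pt {δ : ℝ} (hδ : 0 < δ) (y a : ℝ≥0∞) (ha : a ≠ 0) (hat : a ≠ ⊤) :
    y ^ δ ≤ a ^ δ + ∑' k : ℕ, if 2 ^ k * a < y then (2 ^ (k + 1) * a) ^ δ else 0 := by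
  rcases le_or_gt y a with h | h
  · exact le_add_right (ENNReal.rpow_le_rpow h hδ.le)
  refine le_add_left ?_
  rcases eq_or_ne y ⊤ with rfl | hy
  · have h1 : ∀ k : ℕ, a ^ δ ≤ if 2 ^ k * a < ⊤ then (2 ^ (k + 1) * a) ^ δ else 0 := by
      intro k
      rw [if_pos (ENNReal.mul_lt_top (by simp) hat.lt_top)]
      gcongr
      exact le_mul_of_one_le_left' (one_le_pow₀ (by norm_num))
    have h2 : ∑' _ : ℕ, a ^ δ = ⊤ := by
      rw [ENNReal.tsum_const]
      have : a ^ δ ≠ 0 := by simp [ENNReal.rpow_eq_zero_iff, ha, hat]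
      simp [this]
    calc _ ≤ (⊤ : ℝ≥0∞) := le_top
      _ = ∑' _ : ℕ, a ^ δ := h2.symm
      _ ≤ _ := ENNReal.tsum_le_tsum h1
  · -- finite y
    have hex : ∃ m : ℕ, y ≤ 2 ^ m * a := by
      obtain ⟨m, hm⟩ := ENNReal.exists_nat_gt (ENNReal.div_ne_top hy ha)
      refine ⟨m, ?_⟩
      rw [ENNReal.div_lt_iff (Or.inl ha) (Or.inl hat)] at hm
      refine hm.le.trans ?_
      gcongr
      exact_mod_cast (Nat.lt_two_pow_self (n := m)).le
    classical
    set m := Nat.find hex with hm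
    have hm1 : y ≤ 2 ^ m * a := Nat.find_spec hex
    have hm0 : m ≠ 0 := by
      intro h0
      rw [h0] at hm1
      simp only [pow_zero, one_mul] at hm1
      exact absurd h (not_lt.2 hm1)
    obtain ⟨k, hk⟩ := Nat.exists_eq_succ_of_ne_zero hm0
    have hk2 : 2 ^ k * a < y := not_le.1 (Nat.find_min hex (m := k) (by omega))
    refine le_trans ?_ (ENNReal.le_tsum k)
    rw [if_pos hk2]
    gcongr
    rw [hk] at hm1
    exact hm1

/-- Kolmogorov inequality -/
lemma kolm {δ : ℝ} (hδ : 0 < δ) (hδ1 : δ < 1) : ∃ C : ℝ≥0∞, C ≠ ⊤ ∧ C ≠ 0 ∧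
    ∀ (n : ℕ) (ν : Measure (Eucl n)) (F : Eucl n → ℝ≥0∞) (V K : ℝ≥0∞), Measurable F →
      V ≠ 0 → V ≠ ⊤ → K ≠ 0 → K ≠ ⊤ → ν univ ≤ V →
      (∀ t, t ≠ 0 → t ≠ ⊤ → t * ν {x | t < F x} ≤ K) →
      ∫⁻ x, F x ^ δ ∂ν ≤ C * (K ^ δ * V ^ (1 - δ)) := by
  refine ⟨1 + 2 ^ δ * ∑' k : ℕ, ((2 : ℝ≥0∞) ^ (δ - 1)) ^ k, ?_, ?_, ?_⟩
  · refine ENNReal.add_ne_top.2 ⟨by simp, ENNReal.mul_ne_top ?_ ?_⟩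
    · simp [hδ.le]
    · exact tsum_geom_ne_top (two_rpow_lt_one (by linarith))
  · simp
  intro n ν F V K hF hV0 hVt hK0 hKt hV hw
  set a := K / V with ha
  have ha0 : a ≠ 0 := by simp [ha, ENNReal.div_eq_zero_iff, hK0, hVt]
  have hat : a ≠ ⊤ := ENNReal.div_ne_top hKt hV0
  have haV : a * V = K := ENNReal.div_mul_cancel hV0 hVt
  have hprod : K ^ δ * V ^ (1 - δ) = a ^ δ * V := by
    rw [← haV, ENNReal.mul_rpow_of_nonneg _ _ hδ.le, mul_assoc,
      ← ENNReal.rpow_add _ _ hV0 hVt]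
    simp
  have hms : ∀ k : ℕ, MeasurableSet {x | 2 ^ k * a < F x} := fun k =>
    measurableSet_lt measurable_const hF
  calc ∫⁻ x, F x ^ δ ∂ν
      ≤ ∫⁻ x, (a ^ δ + ∑' k : ℕ,
          ({x | 2 ^ k * a < F x}.indicator (fun _ => (2 ^ (k + 1) * a) ^ δ) x)) ∂ν := by
        refine lintegral_mono fun x => (dyadic_pt hδ (F x) a ha0 hat).trans ?_
        gcongr with k
        simp [indicator_apply]
    _ = a ^ δ * ν univ + ∑' k : ℕ, (2 ^ (k + 1) * a) ^ δ * ν {x | 2 ^ k * a < F x} := by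
        rw [lintegral_add_left measurable_const, lintegral_const, lintegral_tsum]
        · congr 2; ext k
          rw [lintegral_indicator_const (hms k)]
        · intro k
          exact (measurable_const.indicator (hms k)).aemeasurable
    _ ≤ a ^ δ * V + ∑' k : ℕ, 2 ^ δ * ((2 : ℝ≥0∞) ^ (δ - 1)) ^ k * (a ^ δ * V) := by
        refine add_le_add (by gcongr) (ENNReal.tsum_le_tsum fun k => ?_)
        have hb0 : (2 : ℝ≥0∞) ^ k ≠ 0 := by simp
        have hbt : (2 : ℝ≥0∞) ^ k ≠ ⊤ := by simp
        have h1 := hw (2 ^ k * a) (mul_ne_zero hb0 ha0) (ENNReal.mul_ne_top hbt hat)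
        have h2 : 2 ^ k * ν {x | 2 ^ k * a < F x} ≤ V := by
          replace h1 : a * (2 ^ k * ν {x | 2 ^ k * a < F x}) ≤ a * V := by
            rw [haV]; refine le_trans (le_of_eq ?_) h1
            rw [← mul_assoc, mul_comm a]
          exact (ENNReal.mul_le_mul_iff_right ha0 hat).1 h1
        have h3 : ((2 : ℝ≥0∞) ^ (δ - 1)) ^ k * 2 ^ k = (2 ^ k) ^ δ := by
          rw [← two_pow_rpow]
          nth_rewrite 2 [← ENNReal.rpow_one (2 ^ k)]
          rw [← ENNReal.rpow_add _ _ hb0 hbt]; simp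
        rw [pow_succ, ENNReal.mul_rpow_of_nonneg _ _ hδ.le, ENNReal.mul_rpow_of_nonneg _ _ hδ.le,
          ← h3]
        clear hw h1
        generalize ν {x | 2 ^ k * a < F x} = m at h2 ⊢
        calc _ = 2 ^ δ * ((2 : ℝ≥0∞) ^ (δ - 1)) ^ k * (a ^ δ * (2 ^ k * m)) := by
              ring
          _ ≤ _ := by gcongr
    _ = _ := by
        rw [hprod, ENNReal.tsum_mul_right, ENNReal.tsum_mul_left]; ring

/-- Coifman-Rochberg on balls -/
lemma CR_ball (hn : 1 ≤ n) {δ : ℝ} (hδ : 0 < δ) (hδ1 : δ < 1) : ∃ C : ℝ≥0∞, C ≠ ⊤ ∧ C ≠ 0 ∧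
    ∀ (φ : Eucl n → ℝ≥0∞), Measurable φ → (∀ x, Mx φ x ≠ 0) →
      ∀ (x₀ : Eucl n) (R : ℝ), 0 < R → ∀ x ∈ ball x₀ R,
        ∫⁻ y in ball x₀ R, Mx φ y ^ δ ≤ C * (volume (ball x₀ R) * Mx φ x ^ δ) := by
  obtain ⟨C, hCt, hC0, hC⟩ := kolm hδ hδ1
  refine ⟨C * (5 ^ n * 3 ^ n) ^ δ, ?_, ?_, ?_⟩
  · refine ENNReal.mul_ne_top hCt (ENNReal.rpow_ne_top_of_nonneg hδ.le ?_)
    exact ENNReal.mul_ne_top (by simp) (by simp)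
  · exact mul_ne_zero hC0 (rpow_ne_zero_pos (by simp) hδ.le)
  intro φ hφ hpos x₀ R hR x hx
  set V := volume (ball x₀ R) with hV
  have hV0 : V ≠ 0 := vol_ball_pos x₀ hR
  have hVt : V ≠ ⊤ := vol_ball_top x₀ R
  set A := 3 ^ n * Mx φ x with hA
  have hA0 : A ≠ 0 := mul_ne_zero (by simp) (hpos x)
  rcases eq_or_ne (Mx φ x) ⊤ with htop | htop
  · rw [htop, ENNReal.top_rpow_of_pos hδ, ENNReal.mul_top hV0, ENNReal.mul_top]
    · exact le_top
    · exact mul_ne_zero hC0 (rpow_ne_zero_pos (by simp) hδ.le)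
  have hAt : A ≠ ⊤ := ENNReal.mul_ne_top (by simp) htop
  set φ1 := (ball x₀ (3 * R)).indicator φ with hφ1
  have hI : ∫⁻ y, φ1 y ≤ A * V := by
    rw [hφ1, lintegral_indicator measurableSet_ball]
    refine (setLIntegral_le_Mx φ (by positivity)
      (ball_subset_ball (by linarith : R ≤ 3 * R) hx)).trans ?_
    rw [vol_ball_mul x₀ x₀ (by norm_num)]
    simp only [ENNReal.ofReal_ofNat, hA, hV]
    apply le_of_eq; ring
  have hpt : ∀ y ∈ ball x₀ R, Mx φ y ≤ max (Mx φ1 y) A := by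
    intro y hy
    refine Mx_le φ fun z r hr hyz => ?_
    rw [mem_ball] at hx hy hyz
    rcases le_or_gt r R with h | h
    · refine le_max_of_le_left ?_
      refine le_trans ?_ (le_Mx φ1 hr (mem_ball.2 hyz))
      have hsub : ball z r ⊆ ball x₀ (3 * R) := by
        apply ball_subset_ball'
        have := dist_triangle_left z x₀ y
        linarith
      rw [hφ1, setLIntegral_indicator measurableSet_ball, inter_eq_right.2 hsub]
    · refine le_max_of_le_right ?_
      have hx3 : x ∈ ball z (3 * r) := by
        rw [mem_ball]
        have h1 := dist_triangle x y z
        have h2 := dist_triangle_right x y x₀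
        linarith
      rw [ENNReal.div_le_iff (vol_ball_pos z hr) (vol_ball_top z r)]
      calc ∫⁻ y in ball z r, φ y ≤ ∫⁻ y in ball z (3 * r), φ y :=
            lintegral_mono_set (ball_subset_ball (by linarith))
        _ ≤ Mx φ x * volume (ball z (3 * r)) := setLIntegral_le_Mx φ (by positivity) hx3
        _ = A * volume (ball z r) := by
            rw [vol_ball_mul z z (by norm_num)]
            simp only [ENNReal.ofReal_ofNat, hA]; ring
  have hAV0 : A * V ≠ 0 := mul_ne_zero hA0 hV0
  have hAVt : A * V ≠ ⊤ := ENNReal.mul_ne_top hAt hVt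
  have h5 : (1 : ℝ≥0∞) ≤ 5 ^ n := one_le_pow₀ (by norm_num)
  have := hC n (volume.restrict (ball x₀ R)) (Mx φ) V (5 ^ n * (A * V)) (measurable_Mx φ) hV0 hVt
    (mul_ne_zero (by simp) hAV0) (ENNReal.mul_ne_top (by simp) hAVt) (by simp [hV]) (by
      intro t ht0 htt
      rcases le_or_gt t A with h | h
      · calc _ ≤ A * V := by
              gcongr
              rw [hV]
              refine (measure_mono (subset_univ _)).trans ?_
              simp
          _ ≤ _ := le_mul_of_one_le_left' h5
      · calc _ ≤ t * volume {x | t < Mx φ1 x} := by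
              refine mul_le_mul_right ?_ _
              rw [Measure.restrict_apply (measurableSet_lt measurable_const (measurable_Mx φ))]
              refine measure_mono ?_
              rintro y ⟨hy1, hy2⟩
              have := lt_of_lt_of_le (show t < Mx φ y from hy1) (hpt y hy2)
              rcases lt_max_iff.1 this with h' | h'
              · exact h'
              · exact absurd h' (not_lt.2 h.le)
          _ ≤ 5 ^ n * ∫⁻ y, φ1 y := Mx_weak hn φ1 t
          _ ≤ _ := by gcongr)
  refine this.trans (le_of_eq ?_)
  have e : 5 ^ n * (A * V) = (5 ^ n * 3 ^ n) * Mx φ x * V := by rw [hA]; ring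
  rw [e, ENNReal.mul_rpow_of_nonneg _ _ hδ.le, ENNReal.mul_rpow_of_nonneg _ _ hδ.le]
  have e2 : V ^ δ * V ^ (1 - δ) = V := by
    rw [← ENNReal.rpow_add _ _ hV0 hVt]; simp
  calc _ = C * (5 ^ n * 3 ^ n) ^ δ * ((V ^ δ * V ^ (1 - δ)) * Mx φ x ^ δ) := by ring
    _ = _ := by rw [e2]



lemma cubeSet_meas (x : Eucl n) (r : ℝ) : MeasurableSet (cubeSet x r) := by
  apply IsClosed.measurableSet
  have : cubeSet x r = ⋂ i, {y : Eucl n | |x i - y i| ≤ r} := by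
    ext y; simp [cubeSet]
  rw [this]
  refine isClosed_iInter fun i => isClosed_le (by fun_prop) continuous_const

lemma ball_sub_cube (x : Eucl n) (r : ℝ) : ball x r ⊆ cubeSet x r := by
  intro y hy i
  rw [mem_ball, dist_comm, dist_eq_norm] at hy
  have := PiLp.norm_apply_le (x - y) i
  simp only [PiLp.sub_apply, Real.norm_eq_abs] at this
  linarith

lemma cube_sub_ball (x : Eucl n) {r : ℝ} (hr : 0 < r) : cubeSet x r ⊆ ball x ((n + 1) * r) := by
  intro y hy
  rw [mem_ball, dist_comm, dist_eq_norm]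
  have h1 : ‖x - y‖ ≤ n * r := by
    rw [EuclideanSpace.norm_eq]
    apply Real.sqrt_le_iff.2 ⟨by positivity, ?_⟩
    calc ∑ i, ‖(x - y) i‖ ^ 2 ≤ ∑ _i : Fin n, r ^ 2 := by
          refine Finset.sum_le_sum fun i _ => ?_
          have := hy i
          simp only [PiLp.sub_apply, Real.norm_eq_abs]
          gcongr
      _ = n * r ^ 2 := by simp
      _ ≤ (n : ℝ) ^ 2 * r ^ 2 := by
          gcongr
          have : n ≤ n ^ 2 := Nat.le_self_pow (by norm_num) n
          exact_mod_cast this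
      _ = _ := by ring
  linarith

lemma vol_cube_ne_zero (x : Eucl n) {r : ℝ} (hr : 0 < r) : volume (cubeSet x r) ≠ 0 := by
  have := measure_mono (μ := volume) (ball_sub_cube x r)
  exact ((measure_ball_pos volume x hr).trans_le this).ne'

lemma vol_cube_ne_top (x : Eucl n) {r : ℝ} (hr : 0 < r) : volume (cubeSet x r) ≠ ⊤ :=
  ne_top_of_le_ne_top (vol_ball_top _ _) (measure_mono (cube_sub_ball x hr))

/-- A_1 condition on cubes -/
def A1c (w : Eucl n → ℝ≥0∞) (K : ℝ≥0∞) : Prop :=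
  ∀ (x₀ : Eucl n) (r : ℝ), 0 < r → ∀ x ∈ cubeSet x₀ r,
    ∫⁻ y in cubeSet x₀ r, w y ≤ K * (volume (cubeSet x₀ r) * w x)

lemma A1c_one : A1c (n := n) (fun _ => 1) 1 := by
  intro x r hr y hy
  simp

lemma CR_cube (hn : 1 ≤ n) {δ : ℝ} (hδ : 0 < δ) (hδ1 : δ < 1) : ∃ C : ℝ≥0∞, C ≠ ⊤ ∧ C ≠ 0 ∧
    ∀ (φ : Eucl n → ℝ≥0∞), Measurable φ → (∀ x, Mx φ x ≠ 0) →
      A1c (fun x => Mx φ x ^ δ) C := by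
  obtain ⟨C, hCt, hC0, hC⟩ := CR_ball hn hδ hδ1
  have hpos : (0 : ℝ) < n + 1 := by positivity
  refine ⟨C * ENNReal.ofReal (n + 1) ^ n, ENNReal.mul_ne_top hCt (by simp),
    mul_ne_zero hC0 (pow_ne_zero _ (by simp [hpos])), ?_⟩
  intro φ hφ h0 x₀ r hr x hx
  calc _ ≤ ∫⁻ y in ball x₀ ((n + 1) * r), Mx φ y ^ δ := lintegral_mono_set (cube_sub_ball x₀ hr)
    _ ≤ C * (volume (ball x₀ ((n + 1) * r)) * Mx φ x ^ δ) :=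
        hC φ hφ h0 x₀ _ (by positivity) x (cube_sub_ball x₀ hr hx)
    _ = C * ENNReal.ofReal (n + 1) ^ n * (volume (ball x₀ r) * Mx φ x ^ δ) := by
        rw [vol_ball_mul x₀ x₀ hpos]; ring
    _ ≤ _ := by
        gcongr
        exact ball_sub_cube x₀ r

lemma ap_of_A1 {p : ℝ} (hp : 1 < p) {G H : Eucl n → ℝ≥0∞} {KG KH : ℝ≥0∞}
    (hGm : Measurable G) (hHm : Measurable H)
    (hG : A1c G KG) (hH : A1c H KH) (hKG0 : KG ≠ 0) (hKG : KG ≠ ⊤) (hKH0 : KH ≠ 0) (hKH : KH ≠ ⊤)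
    (hGae : ∀ᵐ x, G x ≠ 0 ∧ G x ≠ ⊤) (hHae : ∀ᵐ x, H x ≠ 0 ∧ H x ≠ ⊤) :
    apConst n p (fun x => H x * G x ^ (1 - p)) ≤ KH * KG ^ (p - 1) := by
  have hp1 : 0 < p - 1 := by linarith
  unfold apConst
  refine iSup_le fun x₀ => iSup_le fun r => iSup_le fun hr => ?_
  set Q := cubeSet x₀ r with hQ
  have hQm : MeasurableSet Q := cubeSet_meas x₀ r
  set v := volume Q with hv
  have hv0 : v ≠ 0 := vol_cube_ne_zero x₀ hr
  have hvt : v ≠ ⊤ := vol_cube_ne_top x₀ hr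
  have fin : ∀ (W : Eucl n → ℝ≥0∞) (K : ℝ≥0∞), Measurable W → A1c W K → K ≠ 0 → K ≠ ⊤ →
      (∀ᵐ x, W x ≠ 0 ∧ W x ≠ ⊤) → v⁻¹ * ∫⁻ y in Q, W y ≠ 0 ∧ v⁻¹ * ∫⁻ y in Q, W y ≠ ⊤ ∧
        ∀ x ∈ Q, (v⁻¹ * ∫⁻ y in Q, W y) / K ≤ W x := by
    intro W K hWm hW hK0 hK hae
    have hle : ∀ x ∈ Q, (v⁻¹ * ∫⁻ y in Q, W y) ≤ K * W x := by
      intro x hx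
      have := hW x₀ r hr x hx
      calc _ ≤ v⁻¹ * (K * (v * W x)) := by gcongr
        _ = (v⁻¹ * v) * (K * W x) := by ring
        _ = _ := by rw [ENNReal.inv_mul_cancel hv0 hvt, one_mul]
    refine ⟨?_, ?_, ?_⟩
    · refine mul_ne_zero (by simp [hvt]) ?_
      intro h0
      rw [lintegral_eq_zero_iff hWm] at h0
      have h1 : ∀ᵐ x ∂(volume.restrict Q), False := by
        filter_upwards [h0, ae_restrict_of_ae hae] with x hx hx2
        exact hx2.1 hx
      rw [ae_iff] at h1
      simp at h1
      exact hv0 h1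
    · have : ∃ x ∈ Q, W x ≠ ⊤ := by
        by_contra! hcon
        have : Q ⊆ {x | ¬ (W x ≠ 0 ∧ W x ≠ ⊤)} := by
          intro x hx
          simp [hcon x hx]
        exact hv0 (measure_mono_null this (ae_iff.1 hae))
      obtain ⟨x, hx, hxt⟩ := this
      exact ne_top_of_le_ne_top (ENNReal.mul_ne_top hK hxt) (hle x hx)
    · intro x hx
      rw [ENNReal.div_le_iff hK0 hK, mul_comm (W x)]
      exact hle x hx
  obtain ⟨hg0, hgt, hgle⟩ := fin G KG hGm hG hKG0 hKG hGae
  obtain ⟨hh0, hht, hhle⟩ := fin H KH hHm hH hKH0 hKH hHae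
  set g := v⁻¹ * ∫⁻ y in Q, G y with hgdef
  set h := v⁻¹ * ∫⁻ y in Q, H y with hhdef
  set c := ((g / KG) ^ (p - 1))⁻¹ with hc
  set d := ((h / KH) ^ (1 / (p - 1)))⁻¹ with hd
  have I1 : v⁻¹ * ∫⁻ y in Q, H y * G y ^ (1 - p) ≤ c * h := by
    have : ∫⁻ y in Q, H y * G y ^ (1 - p) ≤ ∫⁻ y in Q, c * H y := by
      refine setLIntegral_mono (hHm.const_mul c) fun y hy => ?_
      rw [mul_comm]
      gcongr
      rw [show 1 - p = -(p - 1) by ring, ENNReal.rpow_neg, hc, ENNReal.inv_le_inv]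
      exact ENNReal.rpow_le_rpow (hgle y hy) hp1.le
    rw [lintegral_const_mul c hHm] at this
    calc _ ≤ v⁻¹ * (c * ∫⁻ y in Q, H y) := by gcongr
      _ = _ := by rw [hhdef]; ring
  have I2 : v⁻¹ * ∫⁻ y in Q, (H y * G y ^ (1 - p)) ^ (-(1 / (p - 1))) ≤ d * g := by
    have : ∫⁻ y in Q, (H y * G y ^ (1 - p)) ^ (-(1 / (p - 1))) ≤ ∫⁻ y in Q, d * G y := by
      refine lintegral_mono_ae ?_
      filter_upwards [ae_restrict_of_ae hGae, ae_restrict_of_ae hHae, ae_restrict_mem hQm]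
        with y hy1 hy2 hy3
      have e1 : G y ^ (1 - p) ≠ 0 := by
        intro h0
        rcases ENNReal.rpow_eq_zero_iff.1 h0 with h1 | h1
        · exact hy1.1 h1.1
        · exact hy1.2 h1.1
      rw [ENNReal.mul_rpow_of_ne_zero hy2.1 e1, ← ENNReal.rpow_mul]
      have e2 : (1 - p) * (-(1 / (p - 1))) = 1 := by field_simp; ring
      rw [e2, ENNReal.rpow_one, ENNReal.rpow_neg]
      gcongr
      rw [hd, ENNReal.inv_le_inv]
      exact ENNReal.rpow_le_rpow (hhle y hy3) (by positivity)
    rw [lintegral_const_mul d hGm] at this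
    calc _ ≤ v⁻¹ * (d * ∫⁻ y in Q, G y) := by gcongr
      _ = _ := by rw [hgdef]; ring
  have key : ∀ a K : ℝ≥0∞, a ≠ 0 → a ≠ ⊤ → K ≠ 0 → K ≠ ⊤ → (a / K)⁻¹ * a = K := by
    intro a K ha hat hK hKt
    rw [ENNReal.inv_div (Or.inl hKt) (Or.inl hK), ENNReal.div_mul_cancel ha hat]
  calc _ ≤ (c * h) * (d * g) ^ (p - 1) := by gcongr
    _ = (d ^ (p - 1) * h) * (c * g ^ (p - 1)) := by
        rw [ENNReal.mul_rpow_of_nonneg _ _ hp1.le]; ring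
    _ = KH * KG ^ (p - 1) := by
        congr 1
        · rw [hd, ENNReal.inv_rpow, ← ENNReal.rpow_mul]
          have : 1 / (p - 1) * (p - 1) = 1 := by field_simp
          rw [this, ENNReal.rpow_one, key h KH hh0 hht hKH0 hKH]
        · rw [hc, ← ENNReal.inv_rpow, ← ENNReal.mul_rpow_of_nonneg _ _ hp1.le,
            key g KG hg0 hgt hKG0 hKG]

lemma one_le_apConst {p : ℝ} (hp : 1 < p) {w : Eucl n → ℝ≥0∞} (hw : IsWeight w) :
    1 ≤ apConst n p w := by
  have hp1 : 0 < p - 1 := by linarith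
  have hp0 : 0 < p := by linarith
  unfold apConst
  refine le_iSup_of_le 0 (le_iSup_of_le 1 (le_iSup_of_le one_pos ?_))
  set Q := cubeSet (0 : Eucl n) 1 with hQ
  set v := volume Q with hv
  have hv0 : v ≠ 0 := vol_cube_ne_zero 0 one_pos
  have hvt : v ≠ ⊤ := vol_cube_ne_top 0 one_pos
  set I := ∫⁻ y in Q, w y with hI
  set J := ∫⁻ y in Q, w y ^ (-(1 / (p - 1))) with hJ
  have hconj : p.HolderConjugate (p / (p - 1)) := Real.HolderConjugate.conjExponent hp
  have h1 : v ≤ I ^ (1 / p) * J ^ ((p - 1) / p) := by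
    have := ENNReal.lintegral_mul_le_Lp_mul_Lq (volume.restrict Q) hconj
      (f := fun y => w y ^ (1 / p)) (g := fun y => w y ^ (-(1 / p)))
      (hw.1.pow_const _).aemeasurable (hw.1.pow_const _).aemeasurable
    have e0 : ∫⁻ y in Q, ((fun y => w y ^ (1 / p)) * fun y => w y ^ (-(1 / p))) y = v := by
      have : ∫⁻ y in Q, ((fun y => w y ^ (1 / p)) * fun y => w y ^ (-(1 / p))) y
          = ∫⁻ y in Q, 1 := by
        refine lintegral_congr_ae ?_
        filter_upwards [ae_restrict_of_ae hw.2] with y hy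
        simp only [Pi.mul_apply]
        rw [← ENNReal.rpow_add _ _ hy.1.ne' hy.2.ne]
        simp
      rw [this]; simp [hv]
    rw [e0] at this
    refine this.trans (le_of_eq ?_)
    congr 1
    · congr 1
      rw [hI]; congr 1; ext y
      rw [← ENNReal.rpow_mul]
      have : 1 / p * p = 1 := by field_simp
      rw [this, ENNReal.rpow_one]
    · rw [show 1 / (p / (p - 1)) = (p - 1) / p by field_simp]
      congr 1
      rw [hJ]; congr 1; ext y
      rw [← ENNReal.rpow_mul]
      congr 1
      field_simp
  have h2 : v ^ p ≤ I * J ^ (p - 1) := by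
    calc v ^ p ≤ (I ^ (1 / p) * J ^ ((p - 1) / p)) ^ p := ENNReal.rpow_le_rpow h1 hp0.le
      _ = _ := by
        rw [ENNReal.mul_rpow_of_nonneg _ _ hp0.le, ← ENNReal.rpow_mul, ← ENNReal.rpow_mul]
        have e1 : 1 / p * p = 1 := by field_simp
        have e2 : (p - 1) / p * p = p - 1 := by field_simp
        rw [e1, e2, ENNReal.rpow_one]
  have hvi0 : v⁻¹ ≠ 0 := by simp [hvt]
  have hvit : v⁻¹ ≠ ⊤ := by simp [hv0]
  calc (1 : ℝ≥0∞) = (v⁻¹) ^ p * v ^ p := by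
        rw [← ENNReal.mul_rpow_of_nonneg _ _ hp0.le, ENNReal.inv_mul_cancel hv0 hvt]
        simp
    _ ≤ (v⁻¹) ^ p * (I * J ^ (p - 1)) := by gcongr
    _ = (v⁻¹ * I) * (v⁻¹ * J) ^ (p - 1) := by
        rw [ENNReal.mul_rpow_of_nonneg _ _ hp1.le]
        have : (v⁻¹) ^ p = v⁻¹ * (v⁻¹) ^ (p - 1) := by
          nth_rewrite 2 [← ENNReal.rpow_one v⁻¹]
          rw [← ENNReal.rpow_add _ _ hvi0 hvit]; congr 1; ring
        rw [this]; ring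

lemma kolm' {q : ℝ} (hq : 1 < q) : ∃ C : ℝ≥0∞, C ≠ ⊤ ∧ C ≠ 0 ∧
    ∀ (n : ℕ) (ν : Measure (Eucl n)) (F : Eucl n → ℝ≥0∞) (V T : ℝ≥0∞), Measurable F →
      V ≠ 0 → V ≠ ⊤ → T ≠ 0 → T ≠ ⊤ → ν univ ≤ V →
      (∀ t, t ≠ 0 → t ≠ ⊤ → t ^ q * ν {x | t < F x} ≤ T) →
      ∫⁻ x, F x ∂ν ≤ C * (T ^ (1 / q) * V ^ (1 - 1 / q)) := by
  have hq0 : 0 < q := by linarith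
  obtain ⟨C, hCt, hC0, hC⟩ := kolm (δ := 1 / q) (by positivity)
    (by rw [div_lt_one hq0]; exact hq)
  refine ⟨C, hCt, hC0, ?_⟩
  intro n ν F V T hF hV0 hVt hT0 hTt hV hw
  have e1 : q * (1 / q) = 1 := by field_simp
  have e2 : 1 / q * q = 1 := by field_simp
  have := hC n ν (fun x => F x ^ q) V T (hF.pow_const q) hV0 hVt hT0 hTt hV (by
    intro t ht0 htt
    have := hw (t ^ (1 / q)) (rpow_ne_zero_pos ht0 (by positivity))
      (ENNReal.rpow_ne_top_of_nonneg (by positivity) htt)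
    rw [← ENNReal.rpow_mul, e2, ENNReal.rpow_one] at this
    refine le_trans (le_of_eq ?_) this
    congr 2
    ext x
    change t < F x ^ q ↔ t ^ (1 / q) < F x
    rw [← ENNReal.rpow_lt_rpow_iff (x := t ^ (1 / q)) hq0, ← ENNReal.rpow_mul, e2,
      ENNReal.rpow_one])
  simpa only [← ENNReal.rpow_mul, e1, ENNReal.rpow_one] using this

lemma Mx_weak_Lb (hn : 1 ≤ n) {b : ℝ} (hb : 1 < b) : ∃ C : ℝ≥0∞, C ≠ ⊤ ∧ C ≠ 0 ∧
    ∀ (φ : Eucl n → ℝ≥0∞) (T : ℝ≥0∞), Measurable φ → T ≠ 0 → T ≠ ⊤ →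
      (∀ t, t ≠ 0 → t ≠ ⊤ → t ^ b * volume {x | t < φ x} ≤ T) →
      (∀ t, t ≠ 0 → t ≠ ⊤ → t ^ b * volume {x | t < Mx φ x} ≤ C * T) := by
  have hb0 : 0 < b := by linarith
  obtain ⟨C, hCt, hC0, hC⟩ := kolm' hb
  refine ⟨2 ^ b * (5 ^ n * C), ?_, ?_, ?_⟩
  · exact ENNReal.mul_ne_top (by simp) (ENNReal.mul_ne_top (by simp) hCt)
  · exact mul_ne_zero (rpow_ne_zero_pos (by simp) hb0.le) (mul_ne_zero (by simp) hC0)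
  intro φ T hφ hT0 hTt hw t ht0 htt
  set s := t / 2 with hs
  have hts : t = 2 * s := by rw [hs, ENNReal.mul_div_cancel (by simp) (by simp)]
  have hs0 : s ≠ 0 := by intro h; simp [hts, h] at ht0
  have hst : s ≠ ⊤ := ENNReal.div_ne_top htt (by simp)
  set A := {x | s < φ x} with hA
  have hAm : MeasurableSet A := measurableSet_lt measurable_const hφ
  set φ1 := A.indicator φ with hφ1
  have hpt : ∀ x, Mx φ x ≤ s + Mx φ1 x := by
    intro x
    refine Mx_le φ fun z r hr hx => ?_
    have h1 : ∫⁻ y in ball z r, φ y ≤ s * volume (ball z r) + ∫⁻ y in ball z r, φ1 y := by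
      rw [← setLIntegral_const, ← lintegral_add_left measurable_const]
      refine lintegral_mono fun y => ?_
      by_cases hy : y ∈ A
      · rw [hφ1, indicator_of_mem hy]; exact le_add_self
      · exact le_add_right (not_lt.1 hy)
    rw [ENNReal.div_le_iff (vol_ball_pos z hr) (vol_ball_top z r), add_mul]
    refine h1.trans ?_
    gcongr
    exact setLIntegral_le_Mx φ1 hr hx
  have hsub : {x | t < Mx φ x} ⊆ {x | s < Mx φ1 x} := by
    intro x hx
    have : 2 * s < s + Mx φ1 x := by rw [← hts]; exact lt_of_lt_of_le hx (hpt x)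
    rw [two_mul] at this
    exact (ENNReal.add_lt_add_iff_left hst).1 this
  have hsb0 : s ^ b ≠ 0 := rpow_ne_zero_pos hs0 hb0.le
  have hsbt : s ^ b ≠ ⊤ := ENNReal.rpow_ne_top_of_nonneg hb0.le hst
  have hI : ∫⁻ y, φ1 y ≤ C * (T ^ (1 / b) * (T / s ^ b) ^ (1 - 1 / b)) := by
    rw [hφ1, lintegral_indicator hAm]
    refine hC n _ φ (T / s ^ b) T hφ ?_ ?_ hT0 hTt ?_ ?_
    · simp [ENNReal.div_eq_zero_iff, hT0, hsbt]
    · exact ENNReal.div_ne_top hTt hsb0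
    · rw [Measure.restrict_apply_univ, ENNReal.le_div_iff_mul_le (Or.inl hsb0) (Or.inl hsbt),
        mul_comm]
      exact hw s hs0 hst
    · intro u hu0 hut
      refine le_trans ?_ (hw u hu0 hut)
      refine mul_le_mul_right ?_ _
      exact Measure.restrict_apply_le _ _
  have e : s ^ b * (T ^ (1 / b) * (T / s ^ b) ^ (1 - 1 / b)) = s * T := by
    have hb1 : 0 ≤ 1 - 1 / b := by
      rw [sub_nonneg, div_le_one hb0]; exact hb.le
    rw [ENNReal.div_rpow_of_nonneg _ _ hb1, ← ENNReal.rpow_mul, ENNReal.div_eq_inv_mul,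
      ← ENNReal.rpow_neg]
    have : s ^ b * (T ^ (1 / b) * (s ^ (-(b * (1 - 1 / b))) * T ^ (1 - 1 / b)))
        = (s ^ b * s ^ (-(b * (1 - 1 / b)))) * (T ^ (1 / b) * T ^ (1 - 1 / b)) := by ring
    rw [this, ← ENNReal.rpow_add _ _ hs0 hst, ← ENNReal.rpow_add _ _ hT0 hTt]
    have e1 : b + -(b * (1 - 1 / b)) = 1 := by field_simp; ring
    have e2 : 1 / b + (1 - 1 / b) = 1 := by ring
    rw [e1, e2, ENNReal.rpow_one, ENNReal.rpow_one]
  have hfin : s * (s ^ b * volume {x | t < Mx φ x}) ≤ s * (5 ^ n * C * T) := by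
    calc _ = s ^ b * (s * volume {x | t < Mx φ x}) := by ring
      _ ≤ s ^ b * (s * volume {x | s < Mx φ1 x}) := by gcongr
      _ ≤ s ^ b * (5 ^ n * (C * (T ^ (1 / b) * (T / s ^ b) ^ (1 - 1 / b)))) := by
          refine mul_le_mul_right ?_ _
          exact (Mx_weak hn φ1 s).trans (by gcongr)
      _ = 5 ^ n * C * (s ^ b * (T ^ (1 / b) * (T / s ^ b) ^ (1 - 1 / b))) := by ring
      _ = _ := by rw [e]; ring
  have hfin' := (ENNReal.mul_le_mul_iff_right hs0 hst).1 hfin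
  calc t ^ b * volume {x | t < Mx φ x} = 2 ^ b * (s ^ b * volume {x | t < Mx φ x}) := by
        nth_rewrite 1 [hts]
        rw [ENNReal.mul_rpow_of_nonneg _ _ hb0.le]; ring
    _ ≤ 2 ^ b * (5 ^ n * C * T) := by gcongr
    _ = _ := by ring



lemma Mx_ind_le_one (E : Set (Eucl n)) (hE : MeasurableSet E) (x : Eucl n) :
    Mx (E.indicator fun _ => 1) x ≤ 1 := by
  refine Mx_le _ fun z r hr hx => ?_
  rw [ENNReal.div_le_iff (vol_ball_pos z hr) (vol_ball_top z r), one_mul]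
  calc _ ≤ ∫⁻ y in ball z r, 1 := by
        refine lintegral_mono fun y => ?_
        exact indicator_le (fun _ _ => le_rfl) y
    _ = _ := by simp

lemma dyadic_small (u G : ℝ≥0∞) (hu : u ≤ 1) :
    G * u ≤ ∑' k : ℕ, if (2⁻¹ : ℝ≥0∞) ^ (k + 1) < u then (2⁻¹ : ℝ≥0∞) ^ k * G else 0 := by
  rcases eq_or_ne u 0 with rfl | h0
  · simp
  have hex : ∃ m : ℕ, (2⁻¹ : ℝ≥0∞) ^ m < u := ENNReal.exists_inv_two_pow_lt h0
  classical
  set m := Nat.find hex with hm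
  have hm1 : (2⁻¹ : ℝ≥0∞) ^ m < u := Nat.find_spec hex
  have hm0 : m ≠ 0 := by
    intro h0
    rw [h0, pow_zero] at hm1
    exact absurd hm1 (not_lt.2 hu)
  obtain ⟨k, hk⟩ := Nat.exists_eq_succ_of_ne_zero hm0
  have hk2 : u ≤ (2⁻¹ : ℝ≥0∞) ^ k := not_lt.1 (Nat.find_min hex (m := k) (by omega))
  refine le_trans ?_ (ENNReal.le_tsum k)
  rw [if_pos (by rw [hk] at hm1; exact hm1), mul_comm]
  gcongr

lemma pairing (hn : 1 ≤ n) {q δ : ℝ} (hq : 1 < q) (hδ0 : 0 < δ) (hδ : 1 - 1 / q < δ) :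
    ∃ C : ℝ≥0∞, C ≠ ⊤ ∧
    ∀ (E : Set (Eucl n)) (G : Eucl n → ℝ≥0∞) (T : ℝ≥0∞), MeasurableSet E → Measurable G →
      volume E ≠ 0 → volume E ≠ ⊤ → T ≠ 0 → T ≠ ⊤ →
      (∀ t, t ≠ 0 → t ≠ ⊤ → t ^ q * volume {x | t < G x} ≤ T) →
      ∫⁻ x, G x * Mx (E.indicator fun _ => 1) x ^ δ ≤ C * (T ^ (1 / q) * volume E ^ (1 - 1 / q)) := by
  have hq0 : 0 < q := by linarith
  have hq1 : 0 < 1 - 1 / q := by rw [sub_pos, div_lt_one hq0]; exact hq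
  obtain ⟨C, hCt, hC0, hC⟩ := kolm' hq
  set θ := 1 / δ * (1 - 1 / q) with hθ
  have hθ1 : θ < 1 := by rw [hθ, one_div_mul_eq_div, div_lt_one hδ0]; exact hδ
  have hθ0 : 0 < θ := by positivity
  refine ⟨C * (5 ^ n) ^ (1 - 1 / q) * (2 ^ θ * ∑' k : ℕ, ((2 : ℝ≥0∞) ^ (θ - 1)) ^ k), ?_, ?_⟩
  · refine ENNReal.mul_ne_top (ENNReal.mul_ne_top hCt
      (ENNReal.rpow_ne_top_of_nonneg hq1.le (by simp))) (ENNReal.mul_ne_top (by simp) ?_)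
    exact tsum_geom_ne_top (two_rpow_lt_one (by linarith))
  intro E G T hE hG hE0 hEt hT0 hTt hw
  set φ : Eucl n → ℝ≥0∞ := E.indicator fun _ => 1 with hφ
  set H := fun x => Mx φ x ^ δ with hH
  have hHm : Measurable H := (measurable_Mx φ).pow_const δ
  have hH1 : ∀ x, H x ≤ 1 := fun x => ENNReal.rpow_le_one (Mx_ind_le_one E hE x) hδ0.le
  set S : ℕ → Set (Eucl n) := fun k => {x | (2⁻¹ : ℝ≥0∞) ^ (k + 1) < H x} with hS
  have hSm : ∀ k, MeasurableSet (S k) := fun k => measurableSet_lt measurable_const hHm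
  set e := volume E with he
  have hφI : ∫⁻ y, φ y = e := by rw [hφ, lintegral_indicator_const hE, one_mul]
  have hSv : ∀ k, volume (S k) ≤ 5 ^ n * e * (2 ^ (k + 1)) ^ (1 / δ) := by
    intro k
    have h1 := Mx_weak hn φ (((2⁻¹ : ℝ≥0∞) ^ (k + 1)) ^ (1 / δ))
    rw [hφI] at h1
    have h2 : {x | ((2⁻¹ : ℝ≥0∞) ^ (k + 1)) ^ (1 / δ) < Mx φ x} = S k := by
      ext x
      change ((2⁻¹ : ℝ≥0∞) ^ (k + 1)) ^ (1 / δ) < Mx φ x ↔ (2⁻¹ : ℝ≥0∞) ^ (k + 1) < Mx φ x ^ δ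
      rw [← ENNReal.rpow_lt_rpow_iff hδ0, ← ENNReal.rpow_mul]
      have : 1 / δ * δ = 1 := by field_simp
      rw [this, ENNReal.rpow_one]
    rw [h2, ← ENNReal.inv_pow, ENNReal.inv_rpow, ← ENNReal.div_eq_inv_mul] at h1
    rwa [ENNReal.div_le_iff (rpow_ne_zero_pos (by simp) (by positivity))
      (ENNReal.rpow_ne_top_of_nonneg (by positivity) (by simp))] at h1
  have hSI : ∀ k, ∫⁻ x in S k, G x ≤
      C * (T ^ (1 / q) * (5 ^ n * e * (2 ^ (k + 1)) ^ (1 / δ)) ^ (1 - 1 / q)) := by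
    intro k
    refine hC n _ G _ T hG ?_ ?_ hT0 hTt ?_ ?_
    · exact mul_ne_zero (mul_ne_zero (by simp) hE0) (rpow_ne_zero_pos (by simp) (by positivity))
    · exact ENNReal.mul_ne_top (ENNReal.mul_ne_top (by simp) hEt)
        (ENNReal.rpow_ne_top_of_nonneg (by positivity) (by simp))
    · rw [Measure.restrict_apply_univ]; exact hSv k
    · intro u hu0 hut
      refine le_trans ?_ (hw u hu0 hut)
      refine mul_le_mul_right ?_ _
      exact Measure.restrict_apply_le _ _
  calc ∫⁻ x, G x * H x ≤ ∫⁻ x, ∑' k : ℕ, (S k).indicator (fun x => (2⁻¹ : ℝ≥0∞) ^ k * G x) x := by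
        refine lintegral_mono fun x => (dyadic_small (H x) (G x) (hH1 x)).trans (le_of_eq ?_)
        congr 1; ext k
        simp [indicator_apply, hS]
    _ = ∑' k : ℕ, (2⁻¹ : ℝ≥0∞) ^ k * ∫⁻ x in S k, G x := by
        rw [lintegral_tsum]
        · congr 1; ext k
          rw [lintegral_indicator (hSm k), lintegral_const_mul _ hG]
        · exact fun k => ((hG.const_mul _).indicator (hSm k)).aemeasurable
    _ ≤ ∑' k : ℕ, (C * (5 ^ n) ^ (1 - 1 / q) * (T ^ (1 / q) * e ^ (1 - 1 / q)) * 2 ^ θ) *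
          ((2 : ℝ≥0∞) ^ (θ - 1)) ^ k := by
        refine ENNReal.tsum_le_tsum fun k => ?_
        refine (mul_le_mul_right (hSI k) _).trans (le_of_eq ?_)
        rw [ENNReal.mul_rpow_of_nonneg _ _ hq1.le, ENNReal.mul_rpow_of_nonneg _ _ hq1.le,
          ← ENNReal.rpow_mul, ← hθ, pow_succ, ENNReal.mul_rpow_of_nonneg _ _ hθ0.le]
        have hb0 : (2 : ℝ≥0∞) ^ k ≠ 0 := by simp
        have hbt : (2 : ℝ≥0∞) ^ k ≠ ⊤ := by simp
        have e1 : ((2 : ℝ≥0∞) ^ (θ - 1)) ^ k = (2 ^ k) ^ θ * (2⁻¹) ^ k := by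
          rw [← two_pow_rpow, ← ENNReal.inv_pow, ENNReal.rpow_sub _ _ hb0 hbt, ENNReal.rpow_one,
            ENNReal.div_eq_inv_mul, mul_comm]
        rw [e1]; ring
    _ = _ := by rw [ENNReal.tsum_mul_left]; ring

lemma wk_zero {q : ℝ} (hq : 1 < q) {g : Eucl n → ℝ} (h : wkLq n q g = 0) :
    ∀ᵐ x, g x = 0 := by
  have hq0 : 0 < q := by linarith
  have h1 : ∀ k : ℕ, volume {x : Eucl n | 1 / ((k : ℝ) + 1) < |g x|} = 0 := by
    intro k
    have hk : (0 : ℝ) < 1 / ((k : ℝ) + 1) := by positivity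
    have h2 : ENNReal.ofReal (1 / ((k : ℝ) + 1)) *
        (volume {x : Eucl n | 1 / ((k : ℝ) + 1) < |g x|}) ^ (1 / q) ≤ 0 := by
      rw [← h]
      exact le_iSup₂_of_le (f := fun (l : ℝ) (_ : 0 < l) =>
        ENNReal.ofReal l * (volume {x : Eucl n | l < |g x|}) ^ (1/q)) _ hk le_rfl
    have h3 := nonpos_iff_eq_zero.1 h2
    rcases mul_eq_zero.1 h3 with h4 | h4
    · rw [ENNReal.ofReal_eq_zero] at h4; linarith
    · by_contra h5
      exact rpow_ne_zero_pos h5 (by positivity) h4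
  have h2 : ∀ᵐ x, ∀ k : ℕ, ¬ (1 / ((k : ℝ) + 1) < |g x|) := by
    rw [ae_all_iff]
    intro k
    rw [ae_iff]
    simpa using h1 k
  filter_upwards [h2] with x hx
  by_contra h0
  obtain ⟨k, hk⟩ := exists_nat_one_div_lt (abs_pos.2 h0)
  exact hx k hk

lemma wk_le {q : ℝ} (hq : 1 < q) (g : Eucl n → ℝ) (t : ℝ≥0∞) (ht0 : t ≠ 0) (htt : t ≠ ⊤) :
    t ^ q * volume {x | t < (‖g x‖₊ : ℝ≥0∞)} ≤ wkLq n q g ^ q := by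
  have hq0 : 0 < q := by linarith
  have ht : 0 < t.toReal := ENNReal.toReal_pos ht0 htt
  have h1 : ENNReal.ofReal t.toReal * (volume {x : Eucl n | t.toReal < |g x|}) ^ (1 / q)
      ≤ wkLq n q g :=
    le_iSup₂_of_le (f := fun (l : ℝ) (_ : 0 < l) =>
        ENNReal.ofReal l * (volume {x : Eucl n | l < |g x|}) ^ (1/q)) _ ht le_rfl
  rw [ENNReal.ofReal_toReal htt] at h1
  have h2 := ENNReal.rpow_le_rpow h1 hq0.le
  rw [ENNReal.mul_rpow_of_nonneg _ _ hq0.le, ← ENNReal.rpow_mul] at h2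
  have : 1 / q * q = 1 := by field_simp
  rw [this, ENNReal.rpow_one] at h2
  refine le_trans (le_of_eq ?_) h2
  congr 2
  ext x
  change t < (‖g x‖₊ : ℝ≥0∞) ↔ t.toReal < |g x|
  rw [← Real.norm_eq_abs, ← coe_nnnorm, ← ENNReal.coe_toReal, ENNReal.toReal_lt_toReal htt (by simp)]



lemma rpow_ne_top_ne {x : ℝ≥0∞} (h0 : x ≠ 0) (ht : x ≠ ⊤) (s : ℝ) : x ^ s ≠ ⊤ := by
  intro h
  rcases ENNReal.rpow_eq_top_iff.1 h with h1 | h1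
  · exact h0 h1.1
  · exact ht h1.1

lemma alg_aux {T e m : ℝ≥0∞} (h0 : e ≠ 0) (ht : e ≠ ⊤) :
    T * (2 * m) = (2 * T / e * m) * e := by
  have : 2 * T / e * m * e = (2 * T / e * e) * m := mul_right_comm _ _ _
  rw [this, ENNReal.div_mul_cancel h0 ht]; ring

/-- the conclusion of `memF` for a product weight, with `p`-th powers -/
lemma apply_memF {p : ℝ} (hp : 1 < p) {N : ℝ → ℝ} (hN : MonotoneOn N (Set.Ici 1))
    {f g : Eucl n → ℝ} (hfg : memF n p N f g)
    {G H : Eucl n → ℝ≥0∞} {KG KH : ℝ≥0∞}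
    (hGm : Measurable G) (hHm : Measurable H)
    (hG : A1c G KG) (hH : A1c H KH) (hKG0 : KG ≠ 0) (hKG : KG ≠ ⊤) (hKH0 : KH ≠ 0) (hKH : KH ≠ ⊤)
    (hGae : ∀ᵐ x, G x ≠ 0 ∧ G x ≠ ⊤) (hHae : ∀ᵐ x, H x ≠ 0 ∧ H x ≠ ⊤) :
    ∫⁻ x, (‖f x‖₊ : ℝ≥0∞) ^ p * (H x * G x ^ (1 - p)) ≤
      ENNReal.ofReal (N (KH * KG ^ (p - 1)).toReal) ^ p *
        ∫⁻ x, (‖g x‖₊ : ℝ≥0∞) ^ p * (H x * G x ^ (1 - p)) := by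
  have hp0 : 0 < p := by linarith
  have hap := ap_of_A1 hp hGm hHm hG hH hKG0 hKG hKH0 hKH hGae hHae
  have hKt : KH * KG ^ (p - 1) ≠ ⊤ :=
    ENNReal.mul_ne_top hKH (ENNReal.rpow_ne_top_of_nonneg (by linarith) hKG)
  have hwt : IsWeight (fun x => H x * G x ^ (1 - p)) := by
    refine ⟨hHm.mul (hGm.pow_const _), ?_⟩
    filter_upwards [hGae, hHae] with x h1 h2
    constructor
    · rw [pos_iff_ne_zero]
      refine mul_ne_zero h2.1 fun h0 => ?_
      rcases ENNReal.rpow_eq_zero_iff.1 h0 with h3 | h3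
      · exact h1.1 h3.1
      · exact h1.2 h3.1
    · exact ENNReal.mul_lt_top h2.2.lt_top (rpow_ne_top_ne h1.1 h1.2 _).lt_top
  have h1 := one_le_apConst hp hwt
  have hat := ne_top_of_le_ne_top hKt hap
  have hm := hfg.2.2 _ ⟨hwt, hat.lt_top⟩
  have h1' : 1 ≤ (apConst n p fun x => H x * G x ^ (1 - p)).toReal := by
    rw [← ENNReal.toReal_one]; exact ENNReal.toReal_mono hat h1
  have hle := ENNReal.toReal_mono hKt hap
  have hNle := hN h1' (show (KH * KG ^ (p - 1)).toReal ∈ Set.Ici 1 from h1'.trans hle) hle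
  have hm2 : wLp n p (fun x => H x * G x ^ (1 - p)) f ≤
      ENNReal.ofReal (N (KH * KG ^ (p - 1)).toReal) * wLp n p (fun x => H x * G x ^ (1 - p)) g :=
    hm.trans (mul_le_mul_left (ENNReal.ofReal_le_ofReal hNle) _)
  have hm3 := ENNReal.rpow_le_rpow hm2 hp0.le
  have e : 1 / p * p = 1 := by field_simp
  rw [ENNReal.mul_rpow_of_nonneg _ _ hp0.le] at hm3
  unfold wLp wLpE at hm3
  rwa [← ENNReal.rpow_mul, ← ENNReal.rpow_mul, e, ENNReal.rpow_one, ENNReal.rpow_one] at hm3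

lemma case_zero {p : ℝ} (hp : 1 < p) {N : ℝ → ℝ} (hN : MonotoneOn N (Set.Ici 1))
    {f g : Eucl n → ℝ} (hfg : memF n p N f g) (hg : ∀ᵐ x, g x = 0) : ∀ᵐ x, f x = 0 := by
  have hp0 : 0 < p := by linarith
  have h := apply_memF hp hN hfg (G := fun _ => 1) (H := fun _ => 1) (KG := 1) (KH := 1)
    measurable_const measurable_const A1c_one A1c_one (by simp) (by simp) (by simp) (by simp)
    (by simp) (by simp)
  have h0 : ∫⁻ x, (‖g x‖₊ : ℝ≥0∞) ^ p * (1 * 1 ^ (1 - p)) = 0 := by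
    rw [lintegral_eq_zero_iff' (by have := hfg.2.1; fun_prop)]
    filter_upwards [hg] with x hx
    simp [hx, hp0]
  rw [h0, mul_zero] at h
  have h := nonpos_iff_eq_zero.1 h
  rw [lintegral_eq_zero_iff' (by have := hfg.1; fun_prop)] at h
  filter_upwards [h] with x hx
  by_contra hfx
  simp only [Pi.zero_apply, ENNReal.one_rpow, mul_one] at hx
  exact rpow_ne_zero_pos (by simpa using hfx) hp0.le hx

lemma main_set (hn : 1 ≤ n) {q : ℝ} (hq : 1 < q) {p : ℝ} (hp : 1 < p)
    {N : ℝ → ℝ} (hN : MonotoneOn N (Set.Ici 1)) :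
    ∃ C : ℝ≥0∞, C ≠ ⊤ ∧ ∀ f g : Eucl n → ℝ, memF n p N f g →
      wkLq n q g ≠ 0 → wkLq n q g ≠ ⊤ → (¬ ∀ᵐ x, g x = 0) →
      ∀ (l : ℝ≥0∞) (E : Set (Eucl n)), MeasurableSet E → volume E ≠ 0 → volume E ≠ ⊤ →
        (∀ x ∈ E, l ≤ (‖f x‖₊ : ℝ≥0∞)) →
        l * volume E ^ (1 / q) ≤ C * wkLq n q g := by
  have hq0 : 0 < q := by linarith
  have hp0 : 0 < p := by linarith
  have hp1 : 0 < p - 1 := by linarith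
  set a := (1 + q) / 2 with ha
  have ha1 : 1 < a := by rw [ha]; linarith
  have ha0 : 0 < a := by linarith
  have haq : a < q := by rw [ha]; linarith
  have hqi : 0 < 1 / q := by positivity
  have hqi1 : 1 / q < 1 := by rw [div_lt_one hq0]; exact hq
  set δ := 1 - 1 / q / 2 with hδ
  have hδ1 : δ < 1 := by rw [hδ]; linarith
  have hδ0 : 0 < δ := by rw [hδ]; linarith
  have hδq : 1 - 1 / q < δ := by rw [hδ]; linarith
  have haa : a * (1 / a) = 1 := by field_simp
  have haa' : 1 / a * a = 1 := by field_simp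
  obtain ⟨KG, hKGt, hKG0, hKG⟩ := CR_cube hn (δ := 1 / a) (by positivity)
    (by rw [div_lt_one ha0]; exact ha1)
  obtain ⟨KH, hKHt, hKH0, hKH⟩ := CR_cube hn hδ0 hδ1
  obtain ⟨C6, hC6t, hC60, hC6⟩ := Mx_weak_Lb hn (b := q / a) (by rw [lt_div_iff₀ ha0]; linarith)
  obtain ⟨C8, hC8t, hC8⟩ := pairing hn hq hδ0 hδq
  set N0 := ENNReal.ofReal (N (KH * KG ^ (p - 1)).toReal) with hN0
  set D := 2 * N0 ^ p * C8 * 2 ^ ((p - 1) / q) with hD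
  have hDt : D ≠ ⊤ := by
    refine ENNReal.mul_ne_top (ENNReal.mul_ne_top (ENNReal.mul_ne_top (by simp) ?_) hC8t) (by simp)
    exact ENNReal.rpow_ne_top_of_nonneg hp0.le (by simp [hN0])
  refine ⟨D ^ (1 / p) * C6 ^ (1 / q), ENNReal.mul_ne_top
    (ENNReal.rpow_ne_top_of_nonneg (by positivity) hDt)
    (ENNReal.rpow_ne_top_of_nonneg (by positivity) hC6t), ?_⟩
  intro f g hfg hT0 hTt hgne l E hE hE0 hEt hlf
  set T0 := wkLq n q g with hT0def
  have hgm := hfg.2.1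
  have hfm := hfg.1
  set φ : Eucl n → ℝ≥0∞ := fun x => (‖g x‖₊ : ℝ≥0∞) ^ a with hφ
  have hφm : Measurable φ := by rw [hφ]; fun_prop
  have hφI : ∫⁻ x, φ x ≠ 0 := by
    intro h
    rw [lintegral_eq_zero_iff hφm] at h
    apply hgne
    filter_upwards [h] with x hx
    by_contra hgx
    exact rpow_ne_zero_pos (by simpa using hgx) ha0.le hx
  have hMφ0 : ∀ x, Mx φ x ≠ 0 := Mx_ne_zero hφI
  set G : Eucl n → ℝ≥0∞ := fun x => Mx φ x ^ (1 / a) with hG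
  have hGm : Measurable G := (measurable_Mx φ).pow_const _
  have hG0 : ∀ x, G x ≠ 0 := fun x => rpow_ne_zero_pos (hMφ0 x) (by positivity)
  have hTq0 : T0 ^ q ≠ 0 := rpow_ne_zero_pos hT0 hq0.le
  have hTqt : T0 ^ q ≠ ⊤ := ENNReal.rpow_ne_top_of_nonneg hq0.le hTt
  set T' := C6 * T0 ^ q with hT'
  have hTp0 : T' ≠ 0 := mul_ne_zero hC60 hTq0
  have hTpt : T' ≠ ⊤ := ENNReal.mul_ne_top hC6t hTqt
  have hMw := hC6 φ (T0 ^ q) hφm hTq0 hTqt (by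
    intro t ht0 htt
    have h1 := wk_le hq g (t ^ (1 / a)) (rpow_ne_zero_pos ht0 (by positivity))
      (ENNReal.rpow_ne_top_of_nonneg (by positivity) htt)
    rw [← ENNReal.rpow_mul, one_div_mul_eq_div] at h1
    refine le_trans (le_of_eq ?_) h1
    congr 2
    ext x
    change t < (‖g x‖₊ : ℝ≥0∞) ^ a ↔ t ^ (1 / a) < (‖g x‖₊ : ℝ≥0∞)
    rw [← ENNReal.rpow_lt_rpow_iff (x := t ^ (1 / a)) ha0, ← ENNReal.rpow_mul, haa',
      ENNReal.rpow_one])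
  have hGw : ∀ t, t ≠ 0 → t ≠ ⊤ → t ^ q * volume {x | t < G x} ≤ T' := by
    intro t ht0 htt
    have h1 := hMw (t ^ a) (rpow_ne_zero_pos ht0 ha0.le)
      (ENNReal.rpow_ne_top_of_nonneg ha0.le htt)
    rw [← ENNReal.rpow_mul, mul_div_cancel₀ q ha0.ne'] at h1
    refine le_trans (le_of_eq ?_) h1
    congr 2
    ext x
    change t < Mx φ x ^ (1 / a) ↔ t ^ a < Mx φ x
    rw [← ENNReal.rpow_lt_rpow_iff (x := t) ha0, ← ENNReal.rpow_mul, haa', ENNReal.rpow_one]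
  set e := volume E with he
  set χ : Eucl n → ℝ≥0∞ := E.indicator fun _ => 1 with hχ
  have hχm : Measurable χ := measurable_const.indicator hE
  have hχI : ∫⁻ x, χ x ≠ 0 := by
    rw [hχ, lintegral_indicator_const hE, one_mul]; exact hE0
  have hMχ0 : ∀ x, Mx χ x ≠ 0 := Mx_ne_zero hχI
  set H : Eucl n → ℝ≥0∞ := fun x => Mx χ x ^ δ with hH
  have hHm : Measurable H := (measurable_Mx χ).pow_const _
  have hH0 : ∀ x, H x ≠ 0 := fun x => rpow_ne_zero_pos (hMχ0 x) hδ0.le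
  have hH1 : ∀ x, H x ≤ 1 := fun x => ENNReal.rpow_le_one (Mx_ind_le_one E hE x) hδ0.le
  have hHE : ∀ᵐ x, x ∈ E → 1 ≤ H x := by
    filter_upwards [ae_le_Mx hχm] with x hx hxE
    rw [hχ, indicator_of_mem hxE] at hx
    exact ENNReal.one_le_rpow hx hδ0
  have hpair : ∫⁻ x, G x * H x ≤ C8 * (T' ^ (1 / q) * e ^ (1 - 1 / q)) :=
    hC8 E G T' hE hGm hE0 hEt hTp0 hTpt hGw
  have hpairt : C8 * (T' ^ (1 / q) * e ^ (1 - 1 / q)) ≠ ⊤ := by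
    refine ENNReal.mul_ne_top hC8t (ENNReal.mul_ne_top
      (ENNReal.rpow_ne_top_of_nonneg hqi.le hTpt) (ENNReal.rpow_ne_top_of_nonneg (by linarith) hEt))
  have hGfin : ∀ᵐ x, G x ≠ ⊤ := by
    filter_upwards [ae_lt_top (hGm.mul hHm) (ne_top_of_le_ne_top hpairt hpair)] with x hx hGx
    rw [Pi.mul_apply, hGx, ENNReal.top_mul (hH0 x)] at hx
    exact lt_irrefl _ hx
  have hgG : ∀ᵐ x, (‖g x‖₊ : ℝ≥0∞) ≤ G x := by
    filter_upwards [ae_le_Mx hφm] with x hx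
    have := ENNReal.rpow_le_rpow hx (by positivity : 0 ≤ 1 / a)
    simp only [hφ] at this
    rwa [← ENNReal.rpow_mul, haa, ENNReal.rpow_one] at this
  have hmain := apply_memF hp hN hfg hGm hHm (hKG φ hφm hMφ0) (hKH χ hχm hMχ0) hKG0 hKGt hKH0 hKHt
    (hGfin.mono fun x hx => ⟨hG0 x, hx⟩)
    (Eventually.of_forall fun x => ⟨hH0 x, ne_top_of_le_ne_top (by simp) (hH1 x)⟩)
  have hgI : ∫⁻ x, (‖g x‖₊ : ℝ≥0∞) ^ p * (H x * G x ^ (1 - p)) ≤ ∫⁻ x, G x * H x := by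
    refine lintegral_mono_ae ?_
    filter_upwards [hGfin, hgG] with x h1 h2
    calc _ ≤ G x ^ p * (H x * G x ^ (1 - p)) := by gcongr
      _ = (G x ^ p * G x ^ (1 - p)) * H x := by ring
      _ = _ := by
        rw [← ENNReal.rpow_add _ _ (hG0 x) h1]; simp
  -- the level μ
  set μ := (2 * T' / e) ^ (1 / q) with hμ
  have hb0 : 2 * T' / e ≠ 0 := by simp [ENNReal.div_eq_zero_iff, hTp0, hEt]
  have hbt : 2 * T' / e ≠ ⊤ := ENNReal.div_ne_top (ENNReal.mul_ne_top (by simp) hTpt) hE0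
  have hμ0 : μ ≠ 0 := rpow_ne_zero_pos hb0 hqi.le
  have hμt : μ ≠ ⊤ := ENNReal.rpow_ne_top_of_nonneg hqi.le hbt
  have hμq : μ ^ q = 2 * T' / e := by
    rw [hμ, ← ENNReal.rpow_mul]
    have : 1 / q * q = 1 := by field_simp
    rw [this, ENNReal.rpow_one]
  have hbad : volume {x | μ < G x} ≤ e / 2 := by
    have h1 := hGw μ hμ0 hμt
    rw [hμq] at h1
    have h2 : T' * (2 * volume {x | μ < G x}) ≤ T' * e := by
      calc _ = (2 * T' / e * volume {x | μ < G x}) * e := alg_aux hE0 hEt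
        _ ≤ _ := by gcongr
    have h3 := (ENNReal.mul_le_mul_iff_right hTp0 hTpt).1 h2
    rw [ENNReal.le_div_iff_mul_le (by simp) (by simp), mul_comm]
    exact h3
  set F := E \ {x | μ < G x} with hF
  have hFm : MeasurableSet F := hE.diff (measurableSet_lt measurable_const hGm)
  have hFv : e / 2 ≤ volume F := by
    have h1 : e ≤ volume F + volume {x | μ < G x} := by
      refine (measure_mono ?_).trans (measure_union_le _ _)
      rw [hF, sdiff_union_self]
      exact subset_union_left
    have h2 : e / 2 + e / 2 ≤ volume F + e / 2 := by
      rw [ENNReal.add_halves]; exact h1.trans (by gcongr)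
    exact (ENNReal.add_le_add_iff_right (ENNReal.div_ne_top hEt (by simp))).1 h2
  have hfI : l ^ p * (μ ^ (p - 1))⁻¹ * (e / 2) ≤
      ∫⁻ x, (‖f x‖₊ : ℝ≥0∞) ^ p * (H x * G x ^ (1 - p)) := by
    calc _ ≤ l ^ p * (μ ^ (p - 1))⁻¹ * volume F := by gcongr
      _ = ∫⁻ x in F, l ^ p * (μ ^ (p - 1))⁻¹ := by rw [setLIntegral_const]
      _ ≤ ∫⁻ x in F, (‖f x‖₊ : ℝ≥0∞) ^ p * (H x * G x ^ (1 - p)) := by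
          refine lintegral_mono_ae ?_
          filter_upwards [ae_restrict_of_ae hHE, ae_restrict_mem hFm] with x h1 h2
          refine mul_le_mul' (ENNReal.rpow_le_rpow (hlf x h2.1) hp0.le) ?_
          calc _ ≤ 1 * G x ^ (1 - p) := by
                rw [one_mul, show 1 - p = -(p - 1) by ring, ENNReal.rpow_neg, ENNReal.inv_le_inv]
                exact ENNReal.rpow_le_rpow (not_lt.1 h2.2) hp1.le
            _ ≤ _ := by
                gcongr
                exact h1 h2.1
      _ ≤ _ := setLIntegral_le_lintegral _ _
  have hcomb : l ^ p * (μ ^ (p - 1))⁻¹ * (e / 2) ≤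
      N0 ^ p * (C8 * (T' ^ (1 / q) * e ^ (1 - 1 / q))) :=
    hfI.trans (hmain.trans (mul_le_mul_right (hgI.trans hpair) _))
  -- arithmetic
  have hμp0 : μ ^ (p - 1) ≠ 0 := rpow_ne_zero_pos hμ0 hp1.le
  have hμpt : μ ^ (p - 1) ≠ ⊤ := ENNReal.rpow_ne_top_of_nonneg hp1.le hμt
  have hμp : μ ^ (p - 1) = 2 ^ ((p - 1) / q) * T' ^ ((p - 1) / q) * e ^ (-((p - 1) / q)) := by
    have hpq : 0 ≤ (p - 1) / q := by positivity
    rw [hμ, ← ENNReal.rpow_mul, one_div_mul_eq_div, ENNReal.div_rpow_of_nonneg _ _ hpq,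
      ENNReal.mul_rpow_of_nonneg _ _ hpq, ENNReal.rpow_neg, div_eq_mul_inv]
  have h1 : l ^ p * e ≤ D * (T' ^ (p / q) * e ^ (1 - p / q)) := by
    calc l ^ p * e = 2 * μ ^ (p - 1) * (l ^ p * (μ ^ (p - 1))⁻¹ * (e / 2)) := by
          have : 2 * μ ^ (p - 1) * (l ^ p * (μ ^ (p - 1))⁻¹ * (e / 2)) =
            l ^ p * (μ ^ (p - 1) * (μ ^ (p - 1))⁻¹) * (2 * (e / 2)) := by ring
          rw [this, ENNReal.mul_inv_cancel hμp0 hμpt, mul_one,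
            ENNReal.mul_div_cancel (by simp) (by simp)]
      _ ≤ 2 * μ ^ (p - 1) * (N0 ^ p * (C8 * (T' ^ (1 / q) * e ^ (1 - 1 / q)))) := by gcongr
      _ = D * ((T' ^ ((p - 1) / q) * T' ^ (1 / q)) * (e ^ (-((p - 1) / q)) * e ^ (1 - 1 / q))) := by
          rw [hμp, hD]; ring
      _ = _ := by
          rw [← ENNReal.rpow_add _ _ hTp0 hTpt, ← ENNReal.rpow_add _ _ hE0 hEt]
          congr 3 <;> ring
  have h2 : (l * e ^ (1 / q)) ^ p ≤ D * T' ^ (p / q) := by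
    have hs0 : e ^ (1 - p / q) ≠ 0 := by
      intro h0
      rcases ENNReal.rpow_eq_zero_iff.1 h0 with h3 | h3
      · exact hE0 h3.1
      · exact hEt h3.1
    have hst : e ^ (1 - p / q) ≠ ⊤ := rpow_ne_top_ne hE0 hEt _
    refine (ENNReal.mul_le_mul_iff_left hs0 hst).1 ?_
    refine le_trans (le_of_eq ?_) (h1.trans (le_of_eq ?_))
    · rw [ENNReal.mul_rpow_of_nonneg _ _ hp0.le, ← ENNReal.rpow_mul, mul_assoc,
        ← ENNReal.rpow_add _ _ hE0 hEt]
      have : 1 / q * p + (1 - p / q) = 1 := by ring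
      rw [this, ENNReal.rpow_one]
    · ring
  have h3 := ENNReal.rpow_le_rpow h2 (by positivity : 0 ≤ 1 / p)
  have hpp : p * (1 / p) = 1 := by field_simp
  rw [← ENNReal.rpow_mul, hpp, ENNReal.rpow_one, ENNReal.mul_rpow_of_nonneg _ _ (by positivity),
    ← ENNReal.rpow_mul] at h3
  have e1 : p / q * (1 / p) = 1 / q := by field_simp
  rw [e1, hT', ENNReal.mul_rpow_of_nonneg _ _ hqi.le, ← ENNReal.rpow_mul] at h3
  have e2 : q * (1 / q) = 1 := by field_simp
  rw [e2, ENNReal.rpow_one] at h3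
  rw [mul_assoc]
  exact h3

end Aux

theorem extrapolation_weak_Lq (n : ℕ) (hn : 1 ≤ n) (q : ℝ) (hq : 1 < q)
    (p : ℝ) (hp : 1 < p)
    (N : ℝ → ℝ) (hN : MonotoneOn N (Set.Ici 1)) (hNpos : ∀ t, 1 ≤ t → 0 < N t) :
    ∃ C : ℝ, 0 < C ∧ ∀ f g : Eucl n → ℝ, memF n p N f g →
      wkLq n q f ≤ ENNReal.ofReal C * wkLq n q g := by
  obtain ⟨C, hCt, hC⟩ := main_set hn hq hp hN
  have hq0 : 0 < q := by linarith
  have hqi : 0 < 1 / q := by positivity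
  refine ⟨C.toReal + 1, by positivity, fun f g hfg => ?_⟩
  have hCle : C ≤ ENNReal.ofReal (C.toReal + 1) := by
    rw [← ENNReal.ofReal_toReal hCt]
    exact ENNReal.ofReal_le_ofReal (by simp)
  have hC0 : ENNReal.ofReal (C.toReal + 1) ≠ 0 := by
    have : 0 < C.toReal + 1 := by positivity
    simpa using this
  rcases eq_or_ne (wkLq n q g) ⊤ with hT | hT
  · rw [hT, ENNReal.mul_top hC0]; exact le_top
  by_cases hg : ∀ᵐ x, g x = 0
  · have hf := case_zero hp hN hfg hg
    refine le_trans (le_of_eq ?_) (zero_le)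
    unfold wkLq
    simp only [ENNReal.iSup_eq_zero]
    intro l hl
    have : volume {x : Eucl n | l < |f x|} = 0 := by
      refine measure_mono_null ?_ (ae_iff.1 hf)
      intro x hx hx0
      have hx : l < |f x| := hx
      rw [hx0, abs_zero] at hx
      linarith
    rw [this, ENNReal.zero_rpow_of_pos hqi, mul_zero]
  have hT0 : wkLq n q g ≠ 0 := fun h => hg (wk_zero hq h)
  refine le_trans ?_ (mul_le_mul_left hCle _)
  refine iSup₂_le fun l hl => ?_
  set S := {x : Eucl n | l < |f x|} with hS
  have hSm : MeasurableSet S := measurableSet_lt measurable_const hfg.1.abs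
  have hk : ∀ k : ℕ, ENNReal.ofReal l * volume (S ∩ ball 0 k) ^ (1 / q) ≤ C * wkLq n q g := by
    intro k
    rcases eq_or_ne (volume (S ∩ ball 0 k)) 0 with h0 | h0
    · rw [h0, ENNReal.zero_rpow_of_pos hqi, mul_zero]; exact zero_le
    refine hC f g hfg hT0 hT hg _ _ (hSm.inter measurableSet_ball) h0
      (ne_top_of_le_ne_top (vol_ball_top 0 k) (measure_mono inter_subset_right)) ?_
    intro x hx
    have : l < |f x| := hx.1
    rw [← Real.norm_eq_abs] at this
    exact (ENNReal.ofReal_le_ofReal this.le).trans (le_of_eq (ofReal_norm (f x)))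
  have hU : S = ⋃ k : ℕ, S ∩ ball 0 (k : ℝ) := by
    rw [← inter_iUnion, iUnion_ball_nat, inter_univ]
  have hmono : Monotone fun k : ℕ => S ∩ ball (0 : Eucl n) (k : ℝ) := by
    intro i j hij
    exact inter_subset_inter_right _ (ball_subset_ball (by exact_mod_cast hij))
  have hlim : Tendsto (fun k : ℕ => ENNReal.ofReal l * volume (S ∩ ball 0 (k : ℝ)) ^ (1 / q)) atTop
      (𝓝 (ENNReal.ofReal l * volume S ^ (1 / q))) := by
    refine ENNReal.Tendsto.const_mul ?_ (Or.inr ENNReal.ofReal_ne_top)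
    refine Tendsto.ennrpow_const _ ?_
    have := tendsto_measure_iUnion_atTop (μ := volume) hmono
    rwa [← hU] at this
  exact le_of_tendsto' hlim hk
end
end
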